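/- Let 0 < σ < p < ∞ and β = 1/σ − 1/p. Then for all 0 < α < β and 0 < q ≤ ∞, the approximation space 𝒜_q^α(L^p(S), 𝒞) coincides with the real interpolation space (L^p(S), V_{σ,p}(S))_{α/β, q}, with equivalence of quasi-norms. -/

import Mathlib

open MeasureTheory ENNReal Set Filter
open scoped ENNReal NNReal Classical

noncomputable section

variable {Ω : Type} [MeasurableSpace Ω]

/-- The data of a filtration on `Ω`, recorded through the (finitely many) atoms of each
σ-algebra `ℱ_n`. -/
structure FiltrationAtoms (Ω : Type) [MeasurableSpace Ω] (μ : Measure Ω) where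
  atoms : ℕ → Set (Set Ω)
  atoms_finite : ∀ n, (atoms n).Finite
  atoms_measurable : ∀ n, ∀ A ∈ atoms n, MeasurableSet A
  atoms_zero : atoms 0 = {Set.univ}
  atoms_disjoint : ∀ n, (atoms n).Pairwise Disjoint
  atoms_cover : ∀ n, ⋃₀ atoms n = Set.univ
  atoms_pos : ∀ n, ∀ A ∈ atoms n, 0 < μ A
  atoms_refine : ∀ n, ∀ B ∈ atoms (n + 1), ∃ A ∈ atoms n, B ⊆ A

namespace FiltrationAtoms

variable {μ : Measure Ω}

/-- The collection `𝒜` of all atoms of the filtration. -/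
def Atoms (F : FiltrationAtoms Ω μ) : Set (Set Ω) := ⋃ n, F.atoms n

/-- A `ν`-ary filtration: every atom of `ℱ_n` is the union of at most `ν` atoms of `ℱ_{n+1}`. -/
def IsNuAry (F : FiltrationAtoms Ω μ) (ν : ℕ) : Prop :=
  ∀ n, ∀ A ∈ F.atoms n, ∃ T : Finset (Set Ω),
    T.card ≤ ν ∧ ↑T ⊆ F.atoms (n + 1) ∧ A = ⋃₀ ↑T

/-- A binary filtration: in the passage from `ℱ_n` to `ℱ_{n+1}`, exactly one atom `A` is
subdivided into two atoms `A'`, `A''` of positive measure with `μ A' ≤ μ A''`. -/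
def IsBinary (F : FiltrationAtoms Ω μ) : Prop :=
  ∀ n, ∃ A ∈ F.atoms n, ∃ A' A'' : Set Ω, A' ∈ F.atoms (n + 1) ∧ A'' ∈ F.atoms (n + 1) ∧
    Disjoint A' A'' ∧ A = A' ∪ A'' ∧ μ A' ≤ μ A'' ∧ 0 < μ A' ∧
    F.atoms (n + 1) = insert A' (insert A'' (F.atoms n \ {A}))

/-- `B` is one of the atoms into which the atom `A` is subdivided. -/
def IsChildOf (F : FiltrationAtoms Ω μ) (B A : Set Ω) : Prop :=
  ∃ n, A ∈ F.atoms n ∧ B ∈ F.atoms (n + 1) ∧ B ⊂ A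

/-- `R` is an atom or a (nonempty) ring, i.e. a difference `A \ B` of two nested atoms. -/
def IsAtomOrRing (F : FiltrationAtoms Ω μ) (R : Set Ω) : Prop :=
  R ∈ F.Atoms ∨ ∃ A ∈ F.Atoms, ∃ B ∈ F.Atoms, B ⊆ A ∧ R = A \ B ∧ R.Nonempty

end FiltrationAtoms

/-- The stability condition on the finite-dimensional space `S`:
there are `c₁, c₂ ∈ (0,1]` with `|{ω ∈ A : |f ω| ≥ c₁ ‖f‖_{L^∞(A)}}| ≥ c₂ |A|` for all
`f ∈ S` and all atoms `A`. -/
def StabilityCondition {μ : Measure Ω} (F : FiltrationAtoms Ω μ)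
    (S : Submodule ℝ (Ω → ℝ)) : Prop :=
  ∃ c₁ ∈ Set.Ioc (0:ℝ) 1, ∃ c₂ ∈ Set.Ioc (0:ℝ) 1,
    ∀ A ∈ F.Atoms, ∀ f ∈ S,
      ENNReal.ofReal c₂ * μ A ≤
        μ {ω | ω ∈ A ∧
          ENNReal.ofReal c₁ * eLpNormEssSup f (μ.restrict A) ≤ ENNReal.ofReal |f ω|}

/-- `E_p(f,R)`: the error of best `L^p(R)`-approximation of `f` by elements of `S` (restricted
to `R`). -/
def Ep (S : Submodule ℝ (Ω → ℝ)) (p : ℝ) (μ : Measure Ω) (f : Ω → ℝ) (R : Set Ω) : ℝ≥0∞ :=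
  ⨅ g ∈ S, eLpNorm (f - g) (ENNReal.ofReal p) (μ.restrict R)

/-- The ring-variation seminorm `|f|_{V_{σ,p}}`: the supremum of
`(∑_{R ∈ P} E_p(f,R)^σ)^{1/σ}` over all finite collections `P` of pairwise disjoint atoms
or rings. -/
def varSeminorm {μ : Measure Ω} (F : FiltrationAtoms Ω μ)
    (S : Submodule ℝ (Ω → ℝ)) (σ p : ℝ) (f : Ω → ℝ) : ℝ≥0∞ :=
  ⨆ (P : Finset (Set Ω)) (_ : ∀ R ∈ P, F.IsAtomOrRing R)
    (_ : (↑P : Set (Set Ω)).Pairwise Disjoint),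
    (∑ R ∈ P, Ep S p μ f R ^ σ) ^ (1 / σ)

/-- The full variation norm `‖f‖_{V_{σ,p}} = ‖f‖_p + |f|_{V_{σ,p}}`. -/
def varNorm {μ : Measure Ω} (F : FiltrationAtoms Ω μ)
    (S : Submodule ℝ (Ω → ℝ)) (σ p : ℝ) (f : Ω → ℝ) : ℝ≥0∞ :=
  eLpNorm f (ENNReal.ofReal p) μ + varSeminorm F S σ p f

/-- The dictionary `𝒞 = {g·1_A : g ∈ S, A ∈ 𝒜}`. -/
def dictC {μ : Measure Ω} (F : FiltrationAtoms Ω μ) (S : Submodule ℝ (Ω → ℝ)) :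
    Set (Ω → ℝ) :=
  {h | ∃ g ∈ S, ∃ A ∈ F.Atoms, h = A.indicator g}

/-- `Σ_n^D`: linear combinations of at most `n` elements of the dictionary `D`. -/
def SigmaN (D : Set (Ω → ℝ)) (n : ℕ) : Set (Ω → ℝ) :=
  {h | ∃ c : Fin n → ℝ, ∃ x : Fin n → Ω → ℝ, (∀ j, x j ∈ D) ∧ h = ∑ j, c j • x j}

/-- `σ_n(f, D)`: the error of best `n`-term approximation in `L^p` with respect to the
dictionary `D`. -/
def bestApprox (D : Set (Ω → ℝ)) (p : ℝ) (μ : Measure Ω) (f : Ω → ℝ) (n : ℕ) : ℝ≥0∞ :=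
  ⨅ y ∈ SigmaN D n, eLpNorm (f - y) (ENNReal.ofReal p) μ

/-- The `ℓ^q` norm (`0 < q ≤ ∞`) of a sequence of extended nonnegative reals. -/
def lqNorm (q : ℝ≥0∞) (a : ℕ → ℝ≥0∞) : ℝ≥0∞ :=
  if q = ∞ then ⨆ n, a n else (∑' n, a n ^ q.toReal) ^ (1 / q.toReal)

/-- The quasi-norm of the approximation space `𝒜_q^α`:
`‖f‖_p + ‖(2^{nα} σ_{2^n}(f,D))_n‖_{ℓ^q}`. -/
def approxNorm (D : Set (Ω → ℝ)) (p : ℝ) (q : ℝ≥0∞) (α : ℝ) (μ : Measure Ω)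
    (f : Ω → ℝ) : ℝ≥0∞ :=
  eLpNorm f (ENNReal.ofReal p) μ +
    lqNorm q (fun n => (2 : ℝ≥0∞) ^ ((n : ℝ) * α) * bestApprox D p μ f (2 ^ n))

/-- Membership in `L^p(S)`, the `L^p`-closure of the span of the dictionary `𝒞`. -/
def MemLpS {μ : Measure Ω} (F : FiltrationAtoms Ω μ) (S : Submodule ℝ (Ω → ℝ)) (p : ℝ)
    (f : Ω → ℝ) : Prop :=
  AEMeasurable f μ ∧ eLpNorm f (ENNReal.ofReal p) μ ≠ ∞ ∧
    ∀ ε : ℝ≥0∞, 0 < ε → ∃ n, ∃ y ∈ SigmaN (dictC F S) n,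
      eLpNorm (f - y) (ENNReal.ofReal p) μ < ε

/-- Membership in the variation space `V_{σ,p}(S)`. -/
def MemVar {μ : Measure Ω} (F : FiltrationAtoms Ω μ) (S : Submodule ℝ (Ω → ℝ)) (σ p : ℝ)
    (f : Ω → ℝ) : Prop :=
  MemLpS F S p f ∧ varSeminorm F S σ p f ≠ ∞

/-- The K-functional `K(f, t, L^p, Y)` for a subset `Y` of functions with (quasi-)norm
`yNorm`. -/
def Kfun (p : ℝ) (μ : Measure Ω) (Y : Set (Ω → ℝ)) (yNorm : (Ω → ℝ) → ℝ≥0∞)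
    (f : Ω → ℝ) (t : ℝ≥0∞) : ℝ≥0∞ :=
  ⨅ g ∈ Y, eLpNorm (f - g) (ENNReal.ofReal p) μ + t * yNorm g

/-- The quasi-norm of the real interpolation space `(L^p, Y)_{θ,q}`, namely
`‖(2^{nθ} K(f, 2^{-n}))_n‖_{ℓ^q}`. -/
def interpNorm (p : ℝ) (μ : Measure Ω) (Y : Set (Ω → ℝ)) (yNorm : (Ω → ℝ) → ℝ≥0∞)
    (θ : ℝ) (q : ℝ≥0∞) (f : Ω → ℝ) : ℝ≥0∞ :=
  lqNorm q (fun n => (2 : ℝ≥0∞) ^ ((n : ℝ) * θ) *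
    Kfun p μ Y yNorm f ((2 : ℝ≥0∞) ^ (-(n : ℝ))))

/-- The modulus of smoothness `𝒲_S(f,t)_{σ,p}`; the supremum ranges over all finite
partitions of `Ω` into pairwise disjoint atoms or rings. -/
def modW {μ : Measure Ω} (F : FiltrationAtoms Ω μ) (S : Submodule ℝ (Ω → ℝ)) (σ p : ℝ)
    (f : Ω → ℝ) (t : ℝ) : ℝ≥0∞ :=
  ⨆ (P : Finset (Set Ω)) (_ : ∀ R ∈ P, F.IsAtomOrRing R)
    (_ : (↑P : Set (Set Ω)).Pairwise Disjoint) (_ : ⋃₀ (↑P : Set (Set Ω)) = Set.univ),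
    min (ENNReal.ofReal t) ((P.card : ℝ≥0∞)⁻¹) ^ (1 / σ - 1 / p) *
      (∑ R ∈ P, Ep S p μ f R ^ σ) ^ (1 / σ)

/-- `h` belongs to `S(ℱ_n)`: on each atom of `ℱ_n`, `h` agrees with some element of `S`. -/
def PiecewiseS {μ : Measure Ω} (F : FiltrationAtoms Ω μ) (S : Submodule ℝ (Ω → ℝ)) (n : ℕ)
    (h : Ω → ℝ) : Prop :=
  ∀ A ∈ F.atoms n, ∃ g ∈ S, Set.EqOn h g A

/-- The near-best approximation operator `W_μ f = ∑_{A ∈ 𝒜_μ} f_A · 1_A` built from a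
selection `fA` of near-best approximants on atoms. -/
def Wop {μ : Measure Ω} (F : FiltrationAtoms Ω μ) (fA : (Ω → ℝ) → Set Ω → Ω → ℝ)
    (f : Ω → ℝ) (n : ℕ) : Ω → ℝ :=
  ∑ A ∈ (F.atoms_finite n).toFinset, A.indicator (fA f A)

end

/-! ### Weighted `ℓ^q` quasi-norms of sequences in `[0, ∞]` -/

theorem ENNReal.add_rpow_le_two_rpow_mul (x y : ℝ≥0∞) {s : ℝ} (hs : 0 ≤ s) :
    (x + y) ^ s ≤ 2 ^ s * (x ^ s + y ^ s) := by
  have h1 : x + y ≤ 2 * max x y := by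
    rw [two_mul]; exact add_le_add (le_max_left _ _) (le_max_right _ _)
  calc (x + y) ^ s ≤ (2 * max x y) ^ s := ENNReal.rpow_le_rpow h1 hs
    _ = 2 ^ s * (max x y) ^ s := ENNReal.mul_rpow_of_nonneg _ _ hs
    _ ≤ 2 ^ s * (x ^ s + y ^ s) := by
      gcongr
      rcases le_total x y with h | h
      · rw [max_eq_right h]; exact le_add_self
      · rw [max_eq_left h]; exact le_self_add

theorem ENNReal.sum_rpow_le_rpow_of_le {q : ℝ} (hq : 0 < q) {x c y : ℝ≥0∞}
    (h : x ≤ c ^ q * y) : x ^ (1 / q) ≤ c * y ^ (1 / q) := by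
  have hq' : (0 : ℝ) ≤ 1 / q := by positivity
  calc x ^ (1 / q) ≤ (c ^ q * y) ^ (1 / q) := ENNReal.rpow_le_rpow h hq'
    _ = c * y ^ (1 / q) := by
      rw [ENNReal.mul_rpow_of_nonneg _ _ hq', ← ENNReal.rpow_mul, mul_one_div_cancel hq.ne',
        ENNReal.rpow_one]

section LqNorm

variable {q : ℝ≥0∞}

theorem lqNorm_mono (q : ℝ≥0∞) {a b : ℕ → ℝ≥0∞} (h : ∀ n, a n ≤ b n) :
    lqNorm q a ≤ lqNorm q b := by
  unfold lqNorm
  split_ifs with hq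
  · exact iSup_mono h
  · gcongr with n
    exact h n

theorem lqNorm_const_mul_le (hq : 0 < q) (c : ℝ≥0∞) (a : ℕ → ℝ≥0∞) :
    lqNorm q (fun n => c * a n) ≤ c * lqNorm q a := by
  unfold lqNorm
  split_ifs with h
  · rw [ENNReal.mul_iSup]
  · have hq' : 0 < q.toReal := ENNReal.toReal_pos hq.ne' h
    refine ENNReal.sum_rpow_le_rpow_of_le hq' ?_
    rw [← ENNReal.tsum_mul_left]
    exact ENNReal.tsum_le_tsum fun n => (ENNReal.mul_rpow_of_nonneg _ _ hq'.le).le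

theorem le_lqNorm (hq : 0 < q) (a : ℕ → ℝ≥0∞) (n : ℕ) : a n ≤ lqNorm q a := by
  unfold lqNorm
  split_ifs with h
  · exact le_iSup a n
  · have hq' : 0 < q.toReal := ENNReal.toReal_pos hq.ne' h
    calc a n = (a n ^ q.toReal) ^ (1 / q.toReal) := by
          rw [← ENNReal.rpow_mul, mul_one_div_cancel hq'.ne', ENNReal.rpow_one]
      _ ≤ _ := by
          gcongr
          exact ENNReal.le_tsum n

theorem lqNorm_add_le (hq : 0 < q) (a b : ℕ → ℝ≥0∞) :
    lqNorm q (fun n => a n + b n) ≤ 2 * 2 ^ (1 / q.toReal) * (lqNorm q a + lqNorm q b) := by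
  unfold lqNorm
  split_ifs with h
  · have h1 : (⨆ n, (a n + b n)) ≤ (⨆ n, a n) + ⨆ n, b n :=
      iSup_le fun n => add_le_add (le_iSup a n) (le_iSup b n)
    refine h1.trans (le_mul_of_one_le_left zero_le ?_)
    simp [h]
  · have hq' : 0 < q.toReal := ENNReal.toReal_pos hq.ne' h
    rw [mul_assoc]
    refine (ENNReal.sum_rpow_le_rpow_of_le (c := 2)
      (y := ∑' n, a n ^ q.toReal + ∑' n, b n ^ q.toReal) hq' ?_).trans ?_
    · rw [← ENNReal.tsum_add, ← ENNReal.tsum_mul_left]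
      exact ENNReal.tsum_le_tsum fun n => ENNReal.add_rpow_le_two_rpow_mul _ _ hq'.le
    · gcongr
      exact ENNReal.add_rpow_le_two_rpow_mul _ _ (by positivity)

theorem lqNorm_single (hq : 0 < q) (x : ℝ≥0∞) :
    lqNorm q (fun n => if n = 0 then x else 0) ≤ x := by
  unfold lqNorm
  split_ifs with h
  · refine iSup_le fun n => ?_
    dsimp only
    split_ifs <;> simp
  · have hq' : 0 < q.toReal := ENNReal.toReal_pos hq.ne' h
    rw [tsum_eq_single 0 (fun n hn => by simp [hn, hq'])]
    simp only [if_true]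
    rw [← ENNReal.rpow_mul, mul_one_div_cancel hq'.ne', ENNReal.rpow_one]

/-- Discrete Hardy inequality for suprema against a geometric weight. -/
theorem exists_lqNorm_geom_iSup_le (hq : 0 < q) {r : ℝ≥0∞} (hr : r < 1) :
    ∃ C : ℝ≥0∞, C ≠ ∞ ∧ ∀ a : ℕ → ℝ≥0∞,
      lqNorm q (fun n => ⨆ x ∈ Finset.HasAntidiagonal.antidiagonal n, r ^ x.1 * a x.2) ≤ C * lqNorm q a := by
  by_cases h : q = ∞
  · refine ⟨1, by simp, fun a => ?_⟩
    simp only [lqNorm, h, if_true, one_mul]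
    refine iSup_le fun n => iSup₂_le fun x _ => ?_
    calc r ^ x.1 * a x.2 ≤ 1 * a x.2 := by gcongr; exact pow_le_one₀ zero_le hr.le
      _ = a x.2 := one_mul _
      _ ≤ _ := le_iSup a _
  · have hq' : 0 < q.toReal := ENNReal.toReal_pos hq.ne' h
    have hs : r ^ q.toReal < 1 := ENNReal.rpow_lt_one hr hq'
    refine ⟨((1 - r ^ q.toReal)⁻¹) ^ (1 / q.toReal), ?_, fun a => ?_⟩
    · refine (ENNReal.rpow_lt_top_of_nonneg (by positivity) ?_).ne
      exact ENNReal.inv_ne_top.2 (tsub_pos_of_lt hs).ne'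
    · simp only [lqNorm, h, if_false]
      rw [← ENNReal.mul_rpow_of_nonneg _ _ (by positivity)]
      gcongr
      have key : ∀ n, (⨆ x ∈ Finset.HasAntidiagonal.antidiagonal n, r ^ x.1 * a x.2) ^ q.toReal ≤
          ∑ x ∈ Finset.HasAntidiagonal.antidiagonal n, (r ^ q.toReal) ^ x.1 * a x.2 ^ q.toReal := by
        intro n
        rw [← ENNReal.le_rpow_inv_iff hq']
        refine iSup₂_le fun x hx => ?_
        rw [ENNReal.le_rpow_inv_iff hq']
        have : (r ^ x.1 * a x.2) ^ q.toReal = (r ^ q.toReal) ^ x.1 * a x.2 ^ q.toReal := by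
          rw [ENNReal.mul_rpow_of_nonneg _ _ hq'.le, ← ENNReal.rpow_natCast,
            ← ENNReal.rpow_natCast, ← ENNReal.rpow_mul, ← ENNReal.rpow_mul, mul_comm q.toReal]
        rw [this]
        exact Finset.single_le_sum (f := fun x : ℕ × ℕ => (r ^ q.toReal) ^ x.1 * a x.2 ^ q.toReal)
          (fun _ _ => zero_le) hx
      refine (ENNReal.tsum_le_tsum key).trans ?_
      have h1 : ∑' n, ∑ x ∈ Finset.HasAntidiagonal.antidiagonal n, (r ^ q.toReal) ^ x.1 * a x.2 ^ q.toReal =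
          ∑' x : ℕ × ℕ, (r ^ q.toReal) ^ x.1 * a x.2 ^ q.toReal := by
        rw [← Finset.HasAntidiagonal.sigmaAntidiagonalEquivProd.tsum_eq, ENNReal.tsum_sigma']
        refine tsum_congr fun n => ?_
        rw [tsum_fintype, ← Finset.sum_coe_sort]
        rfl
      rw [h1, ENNReal.tsum_prod (f := fun i j => (r ^ q.toReal) ^ i * a j ^ q.toReal)]
      simp_rw [ENNReal.tsum_mul_left, ENNReal.tsum_mul_right, ENNReal.tsum_geometric]
      exact le_rfl

theorem exists_lqNorm_comp_floor_le (hq : 0 < q) {γ : ℝ} (hγ : 0 < γ) :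
    ∃ C : ℝ≥0∞, C ≠ ∞ ∧ ∀ a : ℕ → ℝ≥0∞,
      lqNorm q (fun m => a ⌊(m : ℝ) * γ⌋₊) ≤ C * lqNorm q a := by
  by_cases h : q = ∞
  · refine ⟨1, by simp, fun a => ?_⟩
    simp only [lqNorm, h, if_true, one_mul]
    exact iSup_le fun n => le_iSup a _
  · have hq' : 0 < q.toReal := ENNReal.toReal_pos hq.ne' h
    obtain ⟨L, hL⟩ := exists_nat_gt (1 / γ)
    have hL0 : 0 < L := by
      have : (0 : ℝ) < L := lt_trans (by positivity) hL
      exact_mod_cast this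
    refine ⟨(L : ℝ≥0∞) ^ (1 / q.toReal), ?_, fun a => ?_⟩
    · exact (ENNReal.rpow_lt_top_of_nonneg (by positivity) (by simp)).ne
    · simp only [lqNorm, h, if_false]
      rw [← ENNReal.mul_rpow_of_nonneg _ _ (by positivity)]
      gcongr
      let φ : ℕ → ℕ × Fin L := fun m => (⌊(m : ℝ) * γ⌋₊, ⟨m % L, Nat.mod_lt _ hL0⟩)
      have close : ∀ m m' : ℕ, m < m' → ⌊(m : ℝ) * γ⌋₊ = ⌊(m' : ℝ) * γ⌋₊ → m' < m + L := by
        intro m m' hm e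
        have h1 : (⌊(m : ℝ) * γ⌋₊ : ℝ) ≤ m * γ := Nat.floor_le (by positivity)
        have h2 : (m' : ℝ) * γ < ⌊(m' : ℝ) * γ⌋₊ + 1 := Nat.lt_floor_add_one _
        rw [← e] at h2
        have h3 : ((m' : ℝ) - m) * γ < 1 := by linarith
        have h4 : (m' : ℝ) - m < 1 / γ := by rwa [lt_div_iff₀ hγ]
        have h5 : (m' : ℝ) < m + L := by linarith
        exact_mod_cast h5
      have aux : ∀ m m' : ℕ, m < m' → φ m ≠ φ m' := by
        intro m m' hm e
        simp only [φ, Prod.mk.injEq, Fin.mk.injEq] at e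
        have h1 := close m m' hm e.1
        have h2 : (m' - m) % L = 0 := Nat.sub_mod_eq_zero_of_mod_eq e.2.symm
        rw [Nat.mod_eq_of_lt (by omega)] at h2
        omega
      have hφ : Function.Injective φ := by
        intro m m' e
        rcases lt_trichotomy m m' with h | h | h
        · exact absurd e (aux _ _ h)
        · exact h
        · exact absurd e.symm (aux _ _ h)
      refine (ENNReal.tsum_comp_le_tsum_of_injective hφ
        (fun x : ℕ × Fin L => a x.1 ^ q.toReal)).trans ?_
      rw [ENNReal.tsum_prod (f := fun i (_ : Fin L) => a i ^ q.toReal)]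
      simp [tsum_fintype, ENNReal.tsum_mul_left]

end LqNorm

/-! ### `L^p` quasi-norms and their powers -/

section LpQuasiNorm

variable {Ω : Type} [MeasurableSpace Ω] {μ : Measure Ω} {p τ : ℝ}

theorem eLpNorm_ofReal_rpow (hp : 0 < p) (f : Ω → ℝ) (μ : Measure Ω) :
    eLpNorm f (ENNReal.ofReal p) μ ^ p = ∫⁻ x, ‖f x‖ₑ ^ p ∂μ := by
  rw [eLpNorm_eq_lintegral_rpow_enorm_toReal (by simpa using hp) ENNReal.ofReal_ne_top,
    ENNReal.toReal_ofReal hp.le, ← ENNReal.rpow_mul, one_div_mul_cancel hp.ne', ENNReal.rpow_one]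

theorem eLpNorm_add_rpow_le (hτ : 0 < τ) (hτ1 : τ ≤ 1) (hτp : τ ≤ p) {f g : Ω → ℝ}
    (hf : AEMeasurable f μ) (hg : AEMeasurable g μ) :
    eLpNorm (f + g) (ENNReal.ofReal p) μ ^ τ ≤
      eLpNorm f (ENNReal.ofReal p) μ ^ τ + eLpNorm g (ENNReal.ofReal p) μ ^ τ := by
  have hp : 0 < p := hτ.trans_le hτp
  rcases le_total 1 p with h1 | h1
  · calc eLpNorm (f + g) (ENNReal.ofReal p) μ ^ τ
        ≤ (eLpNorm f (ENNReal.ofReal p) μ + eLpNorm g (ENNReal.ofReal p) μ) ^ τ := by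
          gcongr
          exact eLpNorm_add_le hf.aestronglyMeasurable hg.aestronglyMeasurable (by simpa using h1)
      _ ≤ _ := ENNReal.rpow_add_le_add_rpow _ _ hτ.le hτ1
  · have h2 : ∀ h : Ω → ℝ, eLpNorm h (ENNReal.ofReal p) μ ^ τ =
        (∫⁻ x, ‖h x‖ₑ ^ p ∂μ) ^ (τ / p) := fun h => by
      rw [← eLpNorm_ofReal_rpow hp, ← ENNReal.rpow_mul, mul_div_cancel₀ _ hp.ne']
    have h3 : ∫⁻ x, ‖(f + g) x‖ₑ ^ p ∂μ ≤ ∫⁻ x, ‖f x‖ₑ ^ p ∂μ + ∫⁻ x, ‖g x‖ₑ ^ p ∂μ := by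
      rw [← lintegral_add_left' (hf.enorm.pow_const p)]
      refine lintegral_mono fun x => ?_
      calc ‖(f + g) x‖ₑ ^ p ≤ (‖f x‖ₑ + ‖g x‖ₑ) ^ p := by
            gcongr; exact enorm_add_le _ _
        _ ≤ _ := ENNReal.rpow_add_le_add_rpow _ _ hp.le h1
    rw [h2, h2, h2]
    calc (∫⁻ x, ‖(f + g) x‖ₑ ^ p ∂μ) ^ (τ / p)
        ≤ (∫⁻ x, ‖f x‖ₑ ^ p ∂μ + ∫⁻ x, ‖g x‖ₑ ^ p ∂μ) ^ (τ / p) := by gcongr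
      _ ≤ _ := ENNReal.rpow_add_le_add_rpow _ _ (by positivity) ((div_le_one hp).2 hτp)

theorem eLpNorm_sub_rpow_le (hτ : 0 < τ) (hτ1 : τ ≤ 1) (hτp : τ ≤ p) {f g : Ω → ℝ}
    (hf : AEMeasurable f μ) (hg : AEMeasurable g μ) :
    eLpNorm (f - g) (ENNReal.ofReal p) μ ^ τ ≤
      eLpNorm f (ENNReal.ofReal p) μ ^ τ + eLpNorm g (ENNReal.ofReal p) μ ^ τ := by
  rw [sub_eq_add_neg, ← eLpNorm_neg g]
  exact eLpNorm_add_rpow_le hτ hτ1 hτp hf hg.neg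

/-- Quasi-triangle inequality deduced from subadditivity of a power. -/
theorem ENNReal.le_two_rpow_mul_add_of_rpow_le (hτ : 0 < τ) {x a b : ℝ≥0∞}
    (h : x ^ τ ≤ a ^ τ + b ^ τ) : x ≤ 2 ^ (1 / τ) * (a + b) := by
  rw [← ENNReal.rpow_le_rpow_iff hτ, ENNReal.mul_rpow_of_nonneg _ _ hτ.le, ← ENNReal.rpow_mul,
    one_div_mul_cancel hτ.ne', ENNReal.rpow_one, two_mul]
  exact h.trans (add_le_add (ENNReal.rpow_le_rpow le_self_add hτ.le)
    (ENNReal.rpow_le_rpow le_add_self hτ.le))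

end LpQuasiNorm

/-! ### Local errors and the ring-variation seminorm -/

section Variation

variable {Ω : Type} [MeasurableSpace Ω] {μ : Measure Ω} {S : Submodule ℝ (Ω → ℝ)}
  {p σ τ : ℝ}

theorem Ep_le {f g : Ω → ℝ} (hg : g ∈ S) (R : Set Ω) :
    Ep S p μ f R ≤ eLpNorm (f - g) (ENNReal.ofReal p) (μ.restrict R) :=
  iInf₂_le g hg

theorem Ep_le_eLpNorm (f : Ω → ℝ) (R : Set Ω) :
    Ep S p μ f R ≤ eLpNorm f (ENNReal.ofReal p) (μ.restrict R) := by
  simpa using Ep_le (S := S) (f := f) S.zero_mem R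

theorem Ep_empty (f : Ω → ℝ) : Ep S p μ f ∅ = 0 := by
  have := Ep_le_eLpNorm (S := S) (p := p) (μ := μ) f ∅
  simpa using this

theorem exists_eLpNorm_lt_of_Ep_lt {f : Ω → ℝ} {R : Set Ω} {ε : ℝ≥0∞} (h : Ep S p μ f R < ε) :
    ∃ g ∈ S, eLpNorm (f - g) (ENNReal.ofReal p) (μ.restrict R) < ε := by
  simpa [Ep, iInf_lt_iff] using h

theorem Ep_add_rpow_le (hS : ∀ g ∈ S, Measurable g) (hτ : 0 < τ) (hτ1 : τ ≤ 1) (hτp : τ ≤ p)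
    {f g : Ω → ℝ} (hf : AEMeasurable f μ) (hg : AEMeasurable g μ) (R : Set Ω) :
    Ep S p μ (f + g) R ^ τ ≤ Ep S p μ f R ^ τ + Ep S p μ g R ^ τ := by
  have hcont : ∀ h : Ω → ℝ, Ep S p μ h R ^ τ =
      ⨅ u : S, eLpNorm (h - (u : Ω → ℝ)) (ENNReal.ofReal p) (μ.restrict R) ^ τ := by
    intro h
    rw [Ep, iInf_subtype']
    exact (ENNReal.orderIsoRpow τ hτ).map_iInf _
  rw [hcont f, hcont g]
  refine ENNReal.le_iInf_add_iInf fun u v => ?_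
  calc Ep S p μ (f + g) R ^ τ
      ≤ eLpNorm ((f - (u : Ω → ℝ)) + (g - (v : Ω → ℝ))) (ENNReal.ofReal p) (μ.restrict R) ^ τ := by
        gcongr
        refine (Ep_le (S.add_mem u.2 v.2) R).trans_eq ?_
        rw [add_sub_add_comm]
    _ ≤ _ := eLpNorm_add_rpow_le hτ hτ1 hτp
        (hf.restrict.sub (hS _ u.2).aemeasurable) (hg.restrict.sub (hS _ v.2).aemeasurable)

variable {F : FiltrationAtoms Ω μ}

theorem le_varSeminorm (f : Ω → ℝ) {P : Finset (Set Ω)} (hP : ∀ R ∈ P, F.IsAtomOrRing R)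
    (hd : (↑P : Set (Set Ω)).Pairwise Disjoint) :
    (∑ R ∈ P, Ep S p μ f R ^ σ) ^ (1 / σ) ≤ varSeminorm F S σ p f :=
  le_iSup_of_le P (le_iSup_of_le hP (le_iSup_of_le hd le_rfl))

theorem varSeminorm_add_rpow_le (hS : ∀ g ∈ S, Measurable g) (hτ : 0 < τ) (hτ1 : τ ≤ 1)
    (hτσ : τ ≤ σ) (hσp : σ < p) {f g : Ω → ℝ} (hf : AEMeasurable f μ) (hg : AEMeasurable g μ) :
    varSeminorm F S σ p (f + g) ^ τ ≤ varSeminorm F S σ p f ^ τ + varSeminorm F S σ p g ^ τ := by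
  have hσ : 0 < σ := hτ.trans_le hτσ
  rw [← ENNReal.le_rpow_inv_iff hτ]
  refine iSup_le fun P => iSup_le fun hP => iSup_le fun hd => ?_
  rw [ENNReal.le_rpow_inv_iff hτ]
  have e1 : ∀ x : ℝ≥0∞, (x ^ τ) ^ (σ / τ) = x ^ σ := fun x => by
    rw [← ENNReal.rpow_mul, mul_div_cancel₀ _ hτ.ne']
  have e2 : ∀ x : ℝ≥0∞, (x ^ (1 / σ)) ^ τ = x ^ (1 / (σ / τ)) := fun x => by
    rw [← ENNReal.rpow_mul]; congr 1; field_simp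
  have hmink := ENNReal.Lp_add_le P (fun R => Ep S p μ f R ^ τ) (fun R => Ep S p μ g R ^ τ)
    (p := σ / τ) ((one_le_div hτ).2 hτσ)
  simp only [e1] at hmink
  calc ((∑ R ∈ P, Ep S p μ (f + g) R ^ σ) ^ (1 / σ)) ^ τ
      = (∑ R ∈ P, (Ep S p μ (f + g) R ^ τ) ^ (σ / τ)) ^ (1 / (σ / τ)) := by
        rw [e2]; simp only [e1]
    _ ≤ (∑ R ∈ P, (Ep S p μ f R ^ τ + Ep S p μ g R ^ τ) ^ (σ / τ)) ^ (1 / (σ / τ)) := by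
        gcongr with R _
        exact Ep_add_rpow_le hS hτ hτ1 (hτσ.trans hσp.le) hf hg R
    _ ≤ _ := hmink
    _ ≤ _ := by
        rw [← e2, ← e2]
        gcongr
        · exact le_varSeminorm f hP hd
        · exact le_varSeminorm g hP hd

theorem card_mul_rpow_le_varSeminorm_rpow (hσ : 0 < σ) (f : Ω → ℝ) {ε : ℝ≥0∞}
    {P : Finset (Set Ω)} (hP : ∀ R ∈ P, F.IsAtomOrRing R)
    (hd : (↑P : Set (Set Ω)).Pairwise Disjoint) (hε : ∀ R ∈ P, ε ≤ Ep S p μ f R) :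
    (P.card : ℝ≥0∞) * ε ^ σ ≤ varSeminorm F S σ p f ^ σ := by
  rw [← ENNReal.rpow_inv_le_iff hσ, ← one_div]
  refine le_trans ?_ (le_varSeminorm f hP hd)
  gcongr
  rw [← nsmul_eq_mul]
  refine Finset.card_nsmul_le_sum _ _ _ fun R hR => ?_
  gcongr
  exact hε R hR

theorem sum_Ep_rpow_le (hp : 0 < p) (f : Ω → ℝ) {P : Finset (Set Ω)}
    (hm : ∀ R ∈ P, MeasurableSet R) (hd : (↑P : Set (Set Ω)).Pairwise Disjoint) :
    ∑ R ∈ P, Ep S p μ f R ^ p ≤ eLpNorm f (ENNReal.ofReal p) μ ^ p := by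
  calc ∑ R ∈ P, Ep S p μ f R ^ p ≤ ∑ R ∈ P, ∫⁻ x in R, ‖f x‖ₑ ^ p ∂μ := by
        refine Finset.sum_le_sum fun R _ => ?_
        rw [← eLpNorm_ofReal_rpow hp]
        gcongr
        exact Ep_le_eLpNorm f R
    _ = ∫⁻ x in ⋃ R ∈ P, R, ‖f x‖ₑ ^ p ∂μ :=
        (lintegral_biUnion_finset (t := fun R => R) hd hm _).symm
    _ ≤ ∫⁻ x, ‖f x‖ₑ ^ p ∂μ := setLIntegral_le_lintegral _ _
    _ = _ := (eLpNorm_ofReal_rpow hp f μ).symm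

/-- Comparison of the `ℓ^σ` and `ℓ^p` norms of finitely supported families. -/
theorem ENNReal.sum_rpow_one_div_le_card_mul {ι : Type*} (hσ : 0 < σ) (hσp : σ < p)
    (s : Finset ι) (e : ι → ℝ≥0∞) :
    (∑ i ∈ s, e i ^ σ) ^ (1 / σ) ≤
      (s.card : ℝ≥0∞) ^ (1 / σ - 1 / p) * (∑ i ∈ s, e i ^ p) ^ (1 / p) := by
  have hp : 0 < p := hσ.trans hσp
  have h := ENNReal.rpow_sum_le_const_mul_sum_rpow s (fun i => e i ^ σ) (p := p / σ)
    ((one_le_div hσ).2 hσp.le)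
  have h2 := ENNReal.rpow_le_rpow h (z := 1 / p) (by positivity)
  rw [ENNReal.mul_rpow_of_nonneg _ _ (by positivity), ← ENNReal.rpow_mul, ← ENNReal.rpow_mul] at h2
  simp only [← ENNReal.rpow_mul] at h2
  have a1 : p / σ * (1 / p) = 1 / σ := by field_simp
  have a2 : (p / σ - 1) * (1 / p) = 1 / σ - 1 / p := by field_simp
  have a3 : σ * (p / σ) = p := by field_simp
  rwa [a1, a2, a3] at h2

end Variation

/-! ### Geometry of atoms and rings -/

namespace FiltrationAtoms

variable {Ω : Type} [MeasurableSpace Ω] {μ : Measure Ω} (F : FiltrationAtoms Ω μ)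

theorem mem_Atoms {n : ℕ} {A : Set Ω} (hA : A ∈ F.atoms n) : A ∈ F.Atoms :=
  mem_iUnion.2 ⟨n, hA⟩

theorem measurableSet_of_mem_Atoms {A : Set Ω} (hA : A ∈ F.Atoms) : MeasurableSet A := by
  obtain ⟨n, hn⟩ := mem_iUnion.1 hA
  exact F.atoms_measurable n A hn

theorem nonempty_of_mem_Atoms {A : Set Ω} (hA : A ∈ F.Atoms) : A.Nonempty := by
  obtain ⟨n, hn⟩ := mem_iUnion.1 hA
  exact nonempty_of_measure_ne_zero (F.atoms_pos n A hn).ne'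

theorem exists_superset_atom (n k : ℕ) {B : Set Ω} (hB : B ∈ F.atoms (n + k)) :
    ∃ A ∈ F.atoms n, B ⊆ A := by
  induction k generalizing B with
  | zero => exact ⟨B, hB, Subset.rfl⟩
  | succ k ih =>
    obtain ⟨A, hA, hBA⟩ := F.atoms_refine (n + k) B hB
    obtain ⟨A', hA', hAA'⟩ := ih hA
    exact ⟨A', hA', hBA.trans hAA'⟩

theorem subset_or_disjoint {n m : ℕ} (h : n ≤ m) {A B : Set Ω} (hA : A ∈ F.atoms n)
    (hB : B ∈ F.atoms m) : B ⊆ A ∨ Disjoint A B := by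
  obtain ⟨k, rfl⟩ := Nat.exists_eq_add_of_le h
  obtain ⟨A', hA', hBA'⟩ := F.exists_superset_atom n k hB
  by_cases e : A = A'
  · exact Or.inl (e ▸ hBA')
  · exact Or.inr ((F.atoms_disjoint n hA hA' e).mono_right hBA')

theorem nested_or_disjoint {A B : Set Ω} (hA : A ∈ F.Atoms) (hB : B ∈ F.Atoms) :
    A ⊆ B ∨ B ⊆ A ∨ Disjoint A B := by
  obtain ⟨n, hn⟩ := mem_iUnion.1 hA
  obtain ⟨m, hm⟩ := mem_iUnion.1 hB
  rcases le_total n m with h | h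
  · exact Or.inr (F.subset_or_disjoint h hn hm)
  · rcases F.subset_or_disjoint h hm hn with h' | h'
    · exact Or.inl h'
    · exact Or.inr (Or.inr h'.symm)

theorem IsAtomOrRing.exists_eq_diff {F : FiltrationAtoms Ω μ} {R : Set Ω}
    (hR : F.IsAtomOrRing R) :
    ∃ A ∈ F.Atoms, ∃ B, (B = ∅ ∨ B ∈ F.Atoms) ∧ R = A \ B := by
  rcases hR with hR | ⟨A, hA, B, hB, -, rfl, -⟩
  · exact ⟨R, hR, ∅, Or.inl rfl, by simp⟩
  · exact ⟨A, hA, B, Or.inr hB, rfl⟩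

theorem IsAtomOrRing.measurableSet {F : FiltrationAtoms Ω μ} {R : Set Ω}
    (hR : F.IsAtomOrRing R) : MeasurableSet R := by
  obtain ⟨A, hA, B, hB, rfl⟩ := hR.exists_eq_diff
  refine (F.measurableSet_of_mem_Atoms hA).diff ?_
  rcases hB with rfl | hB
  · exact MeasurableSet.empty
  · exact F.measurableSet_of_mem_Atoms hB

theorem isAtomOrRing_diff {A B : Set Ω} (hA : A ∈ F.Atoms) (hB : B = ∅ ∨ B ∈ F.Atoms)
    (hBA : B ⊆ A) (hne : (A \ B).Nonempty) : F.IsAtomOrRing (A \ B) := by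
  rcases hB with rfl | hB
  · exact Or.inl (by simpa using hA)
  · exact Or.inr ⟨A, hA, B, hB, hBA, rfl, hne⟩

/-- Two disjoint sets, each an atom or a ring, are not both cut by the same atom. -/
theorem not_disjoint_of_cut {R R' C : Set Ω} (hR : F.IsAtomOrRing R) (hR' : F.IsAtomOrRing R')
    (hC : C ∈ F.Atoms) (h1 : ¬ Disjoint R C) (h2 : ¬ R ⊆ C) (h1' : ¬ Disjoint R' C)
    (h2' : ¬ R' ⊆ C) : ¬ Disjoint R R' := by
  obtain ⟨A, hA, B, hB, rfl⟩ := hR.exists_eq_diff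
  obtain ⟨A', hA', B', hB', rfl⟩ := hR'.exists_eq_diff
  have super : ∀ A B : Set Ω, A ∈ F.Atoms → ¬ Disjoint (A \ B) C → ¬ A \ B ⊆ C → C ⊆ A := by
    intro A B hA h h'
    rcases F.nested_or_disjoint hA hC with h3 | h3 | h3
    · exact absurd (sdiff_subset.trans h3) h'
    · exact h3
    · exact absurd (h3.mono_left sdiff_subset) h
  have hCA := super A B hA h1 h2
  have hCA' := super A' B' hA' h1' h2'
  have main : ∀ A B A' B' : Set Ω, A ⊆ A' → (B' = ∅ ∨ B' ∈ F.Atoms) → ¬ Disjoint (A \ B) C →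
      ¬ A \ B ⊆ C → ¬ Disjoint (A' \ B') C → ¬ Disjoint (A \ B) (A' \ B') := by
    intro A B A' B' hAA' hB' h1 h2 h1'
    have hB'C : B' ⊆ C ∨ Disjoint B' C := by
      rcases hB' with rfl | hB'
      · exact Or.inl (empty_subset _)
      · rcases F.nested_or_disjoint hB' hC with h | h | h
        · exact Or.inl h
        · exact absurd (disjoint_sdiff_left.mono_right h) h1'
        · exact Or.inr h
    rw [Set.not_disjoint_iff]
    rcases hB'C with h | h
    · obtain ⟨x, hx, hxC⟩ := Set.not_subset.1 h2
      exact ⟨x, hx, hAA' hx.1, fun hxB => hxC (h hxB)⟩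
    · obtain ⟨x, hx, hxC⟩ := Set.not_disjoint_iff.1 h1
      exact ⟨x, hx, hAA' hx.1, fun hxB => Set.disjoint_left.1 h hxB hxC⟩
  rcases F.nested_or_disjoint hA hA' with h | h | h
  · exact main A B A' B' h hB' h1 h2 h1'
  · exact fun hd => main A' B' A B h hB h1' h2' h1 hd.symm
  · obtain ⟨x, hx⟩ := F.nonempty_of_mem_Atoms hC
    exact absurd (hCA' hx) (Set.disjoint_left.1 h (hCA hx))

end FiltrationAtoms

/-! ### The `n`-term classes -/

section SigmaN

variable {Ω : Type} {D : Set (Ω → ℝ)}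

theorem zero_mem_SigmaN_zero : (0 : Ω → ℝ) ∈ SigmaN D 0 :=
  ⟨Fin.elim0, Fin.elim0, fun j => j.elim0, by simp⟩

theorem mem_SigmaN_one {x : Ω → ℝ} (hx : x ∈ D) : x ∈ SigmaN D 1 :=
  ⟨fun _ => 1, fun _ => x, fun _ => hx, by simp⟩

theorem SigmaN_add {a b : ℕ} {x y : Ω → ℝ} (hx : x ∈ SigmaN D a) (hy : y ∈ SigmaN D b) :
    x + y ∈ SigmaN D (a + b) := by
  obtain ⟨c, u, hu, rfl⟩ := hx
  obtain ⟨d, v, hv, rfl⟩ := hy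
  refine ⟨Fin.append c d, Fin.append u v, fun j => ?_, ?_⟩
  · refine Fin.addCases (fun i => ?_) (fun i => ?_) j
    · simpa using hu i
    · simpa using hv i
  · simp [Fin.sum_univ_add]

theorem SigmaN_neg {a : ℕ} {x : Ω → ℝ} (hx : x ∈ SigmaN D a) : -x ∈ SigmaN D a := by
  obtain ⟨c, u, hu, rfl⟩ := hx
  exact ⟨-c, u, hu, by simp⟩

theorem SigmaN_sub {a b : ℕ} {x y : Ω → ℝ} (hx : x ∈ SigmaN D a) (hy : y ∈ SigmaN D b) :
    x - y ∈ SigmaN D (a + b) := by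
  rw [sub_eq_add_neg]; exact SigmaN_add hx (SigmaN_neg hy)

theorem SigmaN_mono (hD : D.Nonempty) {a b : ℕ} (h : a ≤ b) : SigmaN D a ⊆ SigmaN D b := by
  obtain ⟨k, rfl⟩ := Nat.exists_eq_add_of_le h
  obtain ⟨d, hd⟩ := hD
  intro x hx
  have h0 : (0 : Ω → ℝ) ∈ SigmaN D k := ⟨0, fun _ => d, fun _ => hd, by simp⟩
  simpa using SigmaN_add hx h0

theorem SigmaN_sum {ι : Type*} (s : Finset ι) (N : ι → ℕ) (y : ι → Ω → ℝ)
    (h : ∀ i ∈ s, y i ∈ SigmaN D (N i)) : ∑ i ∈ s, y i ∈ SigmaN D (∑ i ∈ s, N i) := by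
  induction s using Finset.induction_on with
  | empty => simpa using zero_mem_SigmaN_zero
  | insert i s hi ih =>
    rw [Finset.sum_insert hi, Finset.sum_insert hi]
    exact SigmaN_add (h i (Finset.mem_insert_self _ _))
      (ih fun j hj => h j (Finset.mem_insert_of_mem hj))

/-- A combination of dictionary elements whose atoms do not cut `R` agrees on `R` with an element
of `S`. -/
theorem exists_eqOn_of_uncut {S : Submodule ℝ (Ω → ℝ)} {n : ℕ} (c : Fin n → ℝ) (g : Fin n → Ω → ℝ) (hg : ∀ j, g j ∈ S)
    (A : Fin n → Set Ω) {R : Set Ω} (h : ∀ j, R ⊆ A j ∨ Disjoint R (A j)) :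
    ∃ u ∈ S, EqOn (∑ j, c j • (A j).indicator (g j)) u R := by
  refine ⟨∑ j, if R ⊆ A j then c j • g j else 0, S.sum_mem fun j _ => ?_, fun x hx => ?_⟩
  · split_ifs
    · exact S.smul_mem _ (hg j)
    · exact S.zero_mem
  · rw [Finset.sum_apply, Finset.sum_apply]
    refine Finset.sum_congr rfl fun j _ => ?_
    split_ifs with hj
    · simp [Set.indicator_of_mem (hj hx)]
    · have hx' : x ∉ A j := Set.disjoint_left.1 ((h j).resolve_left hj) hx
      simp [Set.indicator_of_notMem hx']

variable [MeasurableSpace Ω] {μ : Measure Ω} {F : FiltrationAtoms Ω μ}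
  {S : Submodule ℝ (Ω → ℝ)}

theorem univ_mem_Atoms (F : FiltrationAtoms Ω μ) : (univ : Set Ω) ∈ F.Atoms :=
  F.mem_Atoms (n := 0) (by simp [F.atoms_zero])

theorem dictC_nonempty : (dictC F S).Nonempty :=
  ⟨0, 0, S.zero_mem, univ, univ_mem_Atoms F, by simp⟩

theorem indicator_mem_SigmaN {A : Set Ω} (hA : A = ∅ ∨ A ∈ F.Atoms) {g : Ω → ℝ} (hg : g ∈ S) :
    A.indicator g ∈ SigmaN (dictC F S) 1 := by
  rcases hA with rfl | hA
  · rw [Set.indicator_empty']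
    exact SigmaN_mono dictC_nonempty zero_le_one zero_mem_SigmaN_zero
  · exact mem_SigmaN_one ⟨g, hg, A, hA, rfl⟩

theorem indicator_diff_mem_SigmaN {A B : Set Ω} (hA : A ∈ F.Atoms) (hB : B = ∅ ∨ B ∈ F.Atoms)
    (hBA : B ⊆ A) {g : Ω → ℝ} (hg : g ∈ S) : (A \ B).indicator g ∈ SigmaN (dictC F S) 2 := by
  rw [Set.indicator_sdiff hBA]
  exact SigmaN_sub (indicator_mem_SigmaN (Or.inr hA) hg) (indicator_mem_SigmaN hB hg)

theorem exists_repr_of_mem_SigmaN {n : ℕ} {y : Ω → ℝ} (hy : y ∈ SigmaN (dictC F S) n) :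
    ∃ (c : Fin n → ℝ) (g : Fin n → Ω → ℝ) (A : Fin n → Set Ω), (∀ j, g j ∈ S) ∧
      (∀ j, A j ∈ F.Atoms) ∧ y = ∑ j, c j • (A j).indicator (g j) := by
  obtain ⟨c, x, hx, rfl⟩ := hy
  choose g hg A hA hxe using hx
  exact ⟨c, g, A, hg, hA, by simp_rw [← hxe]⟩

theorem Ep_le_of_eqOn {p : ℝ} {f y u : Ω → ℝ} (hu : u ∈ S) {R : Set Ω} (hR : MeasurableSet R)
    (h : EqOn y u R) : Ep S p μ f R ≤ eLpNorm (f - y) (ENNReal.ofReal p) μ := by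
  refine (Ep_le hu R).trans (le_trans (eLpNorm_congr_ae ?_).le
    (eLpNorm_mono_measure _ Measure.restrict_le_self))
  filter_upwards [ae_restrict_mem hR] with x hx
  simp [h hx]

/-- Bernstein inequality. -/
theorem varSeminorm_le_of_mem_SigmaN {σ p : ℝ} (hσ : 0 < σ) (hσp : σ < p) {n : ℕ} {y : Ω → ℝ}
    (hy : y ∈ SigmaN (dictC F S) n) :
    varSeminorm F S σ p y ≤ (n : ℝ≥0∞) ^ (1 / σ - 1 / p) * eLpNorm y (ENNReal.ofReal p) μ := by
  have hp : 0 < p := hσ.trans hσp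
  have hβ : 0 ≤ 1 / σ - 1 / p := sub_nonneg.2 (one_div_le_one_div_of_le hσ hσp.le)
  obtain ⟨c, g, A, hg, hA, hyrep⟩ := exists_repr_of_mem_SigmaN hy
  refine iSup_le fun P => iSup_le fun hP => iSup_le fun hd => ?_
  let Q := P.filter fun R => ∃ j, ¬ Disjoint R (A j) ∧ ¬ R ⊆ A j
  have hQP : Q ⊆ P := Finset.filter_subset _ _
  have hsum : ∑ R ∈ P, Ep S p μ y R ^ σ = ∑ R ∈ Q, Ep S p μ y R ^ σ := by
    symm
    refine Finset.sum_subset hQP fun R hR hRQ => ?_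
    have hun : ∀ j, R ⊆ A j ∨ Disjoint R (A j) := by
      intro j
      by_contra hj
      push Not at hj
      exact hRQ (Finset.mem_filter.2 ⟨hR, j, hj.2, hj.1⟩)
    obtain ⟨u, hu, hyu⟩ := exists_eqOn_of_uncut c g hg A hun
    rw [← hyrep] at hyu
    have h0 : Ep S p μ y R = 0 := by
      have := Ep_le_of_eqOn (p := p) (f := y) (μ := μ) hu (hP R hR).measurableSet hyu
      simpa using this
    rw [h0, ENNReal.zero_rpow_of_pos hσ]
  have hex : ∀ R ∈ Q, ∃ j, ¬ Disjoint R (A j) ∧ ¬ R ⊆ A j := fun R hR => (Finset.mem_filter.1 hR).2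
  have hcard : Q.card ≤ n := by
    have : Q.card ≤ (Finset.univ : Finset (Fin n)).card := by
      refine Finset.card_le_card_of_forall_subsingleton
        (fun R j => ¬ Disjoint R (A j) ∧ ¬ R ⊆ A j)
        (fun R hR => (hex R hR).imp fun j hj => ⟨Finset.mem_univ _, hj⟩) fun j _ R hR R' hR' => ?_
      by_contra hne
      exact F.not_disjoint_of_cut (hP R (hQP hR.1)) (hP R' (hQP hR'.1)) (hA _) hR.2.1 hR.2.2
        hR'.2.1 hR'.2.2 (hd (hQP hR.1) (hQP hR'.1) hne)
    simpa using this
  rw [hsum]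
  refine (ENNReal.sum_rpow_one_div_le_card_mul hσ hσp Q _).trans ?_
  gcongr
  rw [one_div, ENNReal.rpow_inv_le_iff hp]
  exact sum_Ep_rpow_le hp y (fun R hR => (hP R (hQP hR)).measurableSet)
    (hd.mono (Finset.coe_subset.2 hQP))

theorem memLp_of_mem_SigmaN [IsProbabilityMeasure μ] (hS : ∀ g ∈ S, Measurable g)
    (hSb : ∀ g ∈ S, eLpNormEssSup g μ ≠ ∞) (p : ℝ) {n : ℕ} {y : Ω → ℝ}
    (hy : y ∈ SigmaN (dictC F S) n) : MemLp y (ENNReal.ofReal p) μ := by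
  obtain ⟨c, g, A, hg, hA, rfl⟩ := exists_repr_of_mem_SigmaN hy
  have key : ∀ j, MemLp (c j • (A j).indicator (g j)) (ENNReal.ofReal p) μ := by
    intro j
    have h1 : MemLp (g j) ∞ μ :=
      ⟨(hS _ (hg j)).aestronglyMeasurable, by
        rw [eLpNorm_exponent_top]; exact (hSb _ (hg j)).lt_top⟩
    have h2 : MemLp (g j) (ENNReal.ofReal p) μ := h1.mono_exponent le_top
    have h3 : MemLp ((A j).indicator (g j)) (ENNReal.ofReal p) μ :=
      h2.indicator (F.measurableSet_of_mem_Atoms (hA j))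
    exact h3.const_smul (c j)
  exact memLp_finsetSum' _ fun j _ => key j

theorem memVar_of_mem_SigmaN [IsProbabilityMeasure μ] (hS : ∀ g ∈ S, Measurable g)
    (hSb : ∀ g ∈ S, eLpNormEssSup g μ ≠ ∞) {σ p : ℝ} (hσ : 0 < σ) (hσp : σ < p) {n : ℕ}
    {y : Ω → ℝ} (hy : y ∈ SigmaN (dictC F S) n) : MemVar F S σ p y := by
  have hmem := memLp_of_mem_SigmaN hS hSb p hy
  have hβ : 0 ≤ 1 / σ - 1 / p := sub_nonneg.2 (one_div_le_one_div_of_le hσ hσp.le)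
  refine ⟨⟨hmem.aestronglyMeasurable.aemeasurable, hmem.2.ne, fun ε hε => ⟨n, y, hy, by simpa⟩⟩, ?_⟩
  refine ne_top_of_le_ne_top ?_ (varSeminorm_le_of_mem_SigmaN hσ hσp hy)
  exact ENNReal.mul_ne_top (ENNReal.rpow_lt_top_of_nonneg hβ (by simp)).ne hmem.2.ne

end SigmaN

/-! ### Jackson inequality -/

section Jackson

variable {Ω : Type} [MeasurableSpace Ω] {μ : Measure Ω} {F : FiltrationAtoms Ω μ}
  {S : Submodule ℝ (Ω → ℝ)} {p : ℝ} {f : Ω → ℝ} {ε : ℝ≥0∞} {ν : ℕ}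

/-- State of the bottom-up construction on the atom `A`: on the subatom `B ⊆ A` (possibly empty) an
approximant `y` made of `M` pieces with local error at most `ε` is fixed, the ring `A \ B` still has
local error below `ε`, and the disjoint family `P` of atoms or rings in `B` with local error at
least `ε` pays for the number of pieces. -/
structure PartialApprox (F : FiltrationAtoms Ω μ) (S : Submodule ℝ (Ω → ℝ)) (p : ℝ) (f : Ω → ℝ)
    (ε : ℝ≥0∞) (ν : ℕ) (A B : Set Ω) (M : ℕ) (y : Ω → ℝ) (P : Finset (Set Ω)) : Prop where
  atom : B = ∅ ∨ B ∈ F.Atoms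
  subset : B ⊆ A
  good : Ep S p μ f (A \ B) < ε
  mem : y ∈ SigmaN (dictC F S) (2 * M)
  supp : ∀ x ∉ B, y x = 0
  err : ∫⁻ x in B, ‖f x - y x‖ₑ ^ p ∂μ ≤ M * ε ^ p
  ring : ∀ R ∈ P, F.IsAtomOrRing R
  sub : ∀ R ∈ P, R ⊆ B
  bad : ∀ R ∈ P, ε ≤ Ep S p μ f R
  disj : (↑P : Set (Set Ω)).Pairwise Disjoint
  count : (M = 0 ∧ P = ∅) ∨ M + ν ≤ 2 * ν * P.card

theorem PartialApprox.of_good {A : Set Ω} (h : Ep S p μ f A < ε) :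
    PartialApprox F S p f ε ν A ∅ 0 0 ∅ where
  atom := Or.inl rfl
  subset := empty_subset _
  good := by simpa using h
  mem := zero_mem_SigmaN_zero
  supp := fun _ _ => rfl
  err := by simp
  ring := by simp
  sub := by simp
  bad := by simp
  disj := by simp
  count := Or.inl ⟨rfl, rfl⟩

theorem PartialApprox.complete (hp : 0 < p) {A B : Set Ω} {M : ℕ} {y : Ω → ℝ}
    {P : Finset (Set Ω)} (hA : A ∈ F.Atoms) (h : PartialApprox F S p f ε ν A B M y P) :
    ∃ z ∈ SigmaN (dictC F S) (2 * (M + 1)), (∀ x ∉ A, z x = 0) ∧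
      ∫⁻ x in A, ‖f x - z x‖ₑ ^ p ∂μ ≤ (M + 1 : ℕ) * ε ^ p := by
  obtain ⟨g, hg, hgε⟩ := exists_eLpNorm_lt_of_Ep_lt h.good
  have hAm := F.measurableSet_of_mem_Atoms hA
  have hBm : MeasurableSet B := by
    rcases h.atom with rfl | hB
    · exact MeasurableSet.empty
    · exact F.measurableSet_of_mem_Atoms hB
  refine ⟨y + (A \ B).indicator g, SigmaN_add h.mem (indicator_diff_mem_SigmaN hA h.atom h.subset hg),
    fun x hx => ?_, ?_⟩
  · simp [h.supp x (fun hxB => hx (h.subset hxB)), hx]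
  · have hAB : A = B ∪ A \ B := (union_sdiff_cancel h.subset).symm
    have e1 : ∫⁻ x in B, ‖f x - (y + (A \ B).indicator g) x‖ₑ ^ p ∂μ =
        ∫⁻ x in B, ‖f x - y x‖ₑ ^ p ∂μ :=
      setLIntegral_congr_fun hBm fun x hx => by simp [hx]
    have e2 : ∫⁻ x in A \ B, ‖f x - (y + (A \ B).indicator g) x‖ₑ ^ p ∂μ =
        ∫⁻ x in A \ B, ‖(f - g) x‖ₑ ^ p ∂μ :=
      setLIntegral_congr_fun (hAm.diff hBm) fun x hx => by
        simp [h.supp x hx.2, hx.1, hx.2]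
    have e3 : ∫⁻ x in A \ B, ‖(f - g) x‖ₑ ^ p ∂μ ≤ ε ^ p := by
      rw [← eLpNorm_ofReal_rpow hp]
      gcongr
    calc ∫⁻ x in A, ‖f x - (y + (A \ B).indicator g) x‖ₑ ^ p ∂μ
        = ∫⁻ x in B ∪ A \ B, ‖f x - (y + (A \ B).indicator g) x‖ₑ ^ p ∂μ := by rw [← hAB]
      _ = ∫⁻ x in B, ‖f x - y x‖ₑ ^ p ∂μ + ∫⁻ x in A \ B, ‖(f - g) x‖ₑ ^ p ∂μ := by
          rw [lintegral_union (hAm.diff hBm) disjoint_sdiff_right, e1, e2]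
      _ ≤ M * ε ^ p + ε ^ p := add_le_add h.err e3
      _ = _ := by push_cast; ring

/-- Gluing local approximants along finitely many disjoint sets. -/
theorem exists_glue {T : Finset (Set Ω)} (hT : (↑T : Set (Set Ω)).Pairwise Disjoint)
    (hTm : ∀ C ∈ T, MeasurableSet C) (N : Set Ω → ℕ)
    (h : ∀ C ∈ T, ∃ z ∈ SigmaN (dictC F S) (2 * N C), (∀ x ∉ C, z x = 0) ∧
      ∫⁻ x in C, ‖f x - z x‖ₑ ^ p ∂μ ≤ N C * ε ^ p) :
    ∃ z ∈ SigmaN (dictC F S) (2 * ∑ C ∈ T, N C), (∀ x ∉ ⋃₀ (↑T : Set (Set Ω)), z x = 0) ∧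
      ∫⁻ x in ⋃₀ (↑T : Set (Set Ω)), ‖f x - z x‖ₑ ^ p ∂μ ≤ (∑ C ∈ T, N C : ℕ) * ε ^ p := by
  choose! z hz hz0 hzε using h
  refine ⟨∑ C ∈ T, z C, ?_, fun x hx => ?_, ?_⟩
  · rw [Finset.mul_sum]
    exact SigmaN_sum T _ z hz
  · rw [Finset.sum_apply]
    exact Finset.sum_eq_zero fun C hC => hz0 C hC x fun hxC => hx ⟨C, hC, hxC⟩
  · have hU : ⋃₀ (↑T : Set (Set Ω)) = ⋃ C ∈ T, C := by ext; simp
    rw [hU, lintegral_biUnion_finset (t := fun C => C) hT hTm, Nat.cast_sum, Finset.sum_mul]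
    refine Finset.sum_le_sum fun C hC => le_trans (le_of_eq ?_) (hzε C hC)
    refine setLIntegral_congr_fun (hTm C hC) fun x hx => ?_
    have : (∑ C ∈ T, z C) x = z C x := by
      rw [Finset.sum_apply]
      refine Finset.sum_eq_single C (fun C' hC' hne => hz0 C' hC' x fun hx' => ?_)
        (fun h => absurd hC h)
      exact Set.disjoint_left.1 (hT hC' hC hne) hx' hx
    simp only [this]

theorem exists_partialApprox (hFν : F.IsNuAry ν) (hν : 0 < ν) (hp : 0 < p) (hε : 0 < ε) {m : ℕ}
    (hm : ∀ A ∈ F.atoms m, Ep S p μ f A < ε) (j : ℕ) :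
    ∀ n, n + j = m → ∀ A ∈ F.atoms n, ∃ B M y P, PartialApprox F S p f ε ν A B M y P := by
  induction j with
  | zero =>
    rintro n rfl A hA
    exact ⟨∅, 0, 0, ∅, .of_good (hm A hA)⟩
  | succ j ih =>
    intro n hn A hA
    have hAA := F.mem_Atoms hA
    obtain ⟨T, hTν, hTF, hAT⟩ := hFν n A hA
    have hTA : ∀ C ∈ T, C ∈ F.Atoms := fun C hC => F.mem_Atoms (hTF hC)
    have hTd : (↑T : Set (Set Ω)).Pairwise Disjoint := (F.atoms_disjoint (n + 1)).mono hTF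
    have hCA : ∀ C ∈ T, C ⊆ A := fun C hC x hx => hAT ▸ ⟨C, hC, hx⟩
    have hch : ∀ C ∈ T, ∃ B M y P, PartialApprox F S p f ε ν C B M y P :=
      fun C hC => ih (n + 1) (by omega) C (hTF hC)
    choose! B M y P hPA using hch
    have nonempty_of_bad : ∀ {R : Set Ω}, ε ≤ Ep S p μ f R → R.Nonempty := by
      intro R hR
      rw [nonempty_iff_ne_empty]
      rintro rfl
      rw [Ep_empty] at hR
      exact absurd hε (not_lt.2 hR)
    obtain ⟨z, hz, hz0, hzε⟩ := exists_glue (f := f) (p := p) (ε := ε) hTd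
      (fun C hC => F.measurableSet_of_mem_Atoms (hTA C hC)) (fun C => M C + 1)
      (fun C hC => (hPA C hC).complete hp (hTA C hC))
    rw [← hAT] at hz0 hzε
    have hfull : ∀ Q : Finset (Set Ω), (∀ R ∈ Q, F.IsAtomOrRing R) → (∀ R ∈ Q, R ⊆ A) →
        (∀ R ∈ Q, ε ≤ Ep S p μ f R) → (↑Q : Set (Set Ω)).Pairwise Disjoint →
        (∑ C ∈ T, (M C + 1)) + ν ≤ 2 * ν * Q.card →
        ∃ B M y P, PartialApprox F S p f ε ν A B M y P := fun Q h1 h2 h3 h4 h5 =>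
      ⟨A, _, z, Q, Or.inr hAA, Subset.rfl, by rw [sdiff_self]; exact (Ep_empty f).trans_lt hε,
        hz, hz0, hzε, h1, h2, h3, h4, Or.inr h5⟩
    let T' := T.filter fun C => (P C).Nonempty
    have hT'T : T' ⊆ T := Finset.filter_subset _ _
    have hM0 : ∀ C ∈ T, C ∉ T' → M C = 0 := by
      intro C hC hCT'
      rcases (hPA C hC).count with h | h
      · exact h.1
      · have : P C = ∅ := by
          by_contra hne
          exact hCT' (Finset.mem_filter.2 ⟨hC, Finset.nonempty_iff_ne_empty.2 hne⟩)
        rw [this] at h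
        simp at h
        omega
    have hcount : ∀ C ∈ T', M C + ν ≤ 2 * ν * (P C).card := by
      intro C hC
      obtain ⟨hC, hne⟩ := Finset.mem_filter.1 hC
      rcases (hPA C hC).count with h | h
      · exact absurd h.2 hne.ne_empty
      · exact h
    have hMsum : ∑ C ∈ T, (M C + 1) ≤ ∑ C ∈ T', M C + ν := by
      rw [Finset.sum_add_distrib, Finset.sum_subset hT'T hM0]
      simpa using hTν
    by_cases hgood : Ep S p μ f A < ε
    · exact ⟨∅, 0, 0, ∅, .of_good hgood⟩
    rw [not_lt] at hgood
    rcases Nat.lt_trichotomy T'.card 1 with ht | ht | ht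
    · have hT' : T' = ∅ := by rw [← Finset.card_eq_zero]; omega
      rw [hT'] at hMsum
      refine hfull {A} (fun R hR => by rw [Finset.mem_singleton.1 hR]; exact Or.inl hAA) (by simp) (by simpa using hgood) (by simp) ?_
      simp at hMsum ⊢
      omega
    · obtain ⟨C, hC⟩ := Finset.card_eq_one.1 ht
      have hCT' : C ∈ T' := by rw [hC]; exact Finset.mem_singleton_self C
      have hCT := hT'T hCT'
      have hP := hPA C hCT
      by_cases hgood' : Ep S p μ f (A \ B C) < ε
      · exact ⟨B C, M C, y C, P C, hP.atom, hP.subset.trans (hCA C hCT), hgood', hP.mem, hP.supp,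
          hP.err, hP.ring, hP.sub, hP.bad, hP.disj, hP.count⟩
      · rw [not_lt] at hgood'
        have hdis : ∀ R ∈ P C, Disjoint (A \ B C) R := fun R hR =>
          disjoint_sdiff_left.mono_right (hP.sub R hR)
        have hnot : A \ B C ∉ P C := fun hmem =>
          (nonempty_of_bad hgood').ne_empty (disjoint_self.1 (hdis _ hmem))
        have hBA := hP.subset.trans (hCA C hCT)
        refine hfull (insert (A \ B C) (P C)) ?_ ?_ ?_ ?_ ?_
        · intro R hR
          rcases Finset.mem_insert.1 hR with rfl | hR
          · exact F.isAtomOrRing_diff hAA hP.atom hBA (nonempty_of_bad hgood')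
          · exact hP.ring R hR
        · intro R hR
          rcases Finset.mem_insert.1 hR with rfl | hR
          · exact sdiff_subset
          · exact (hP.sub R hR).trans hBA
        · intro R hR
          rcases Finset.mem_insert.1 hR with rfl | hR
          · exact hgood'
          · exact hP.bad R hR
        · rw [Finset.coe_insert]
          exact hP.disj.insert fun R hR _ => ⟨hdis R hR, (hdis R hR).symm⟩
        · rw [Finset.card_insert_of_notMem hnot]
          have := hcount C hCT'
          rw [hC] at hMsum
          simp only [Finset.sum_singleton] at hMsum
          nlinarith
    · have hdisT : ∀ C ∈ T, ∀ C' ∈ T, C ≠ C' → ∀ R ∈ P C, ∀ R' ∈ P C', Disjoint R R' :=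
        fun C hC C' hC' hne R hR R' hR' => (hTd hC hC' hne).mono
          (((hPA C hC).sub R hR).trans (hPA C hC).subset)
          (((hPA C' hC').sub R' hR').trans (hPA C' hC').subset)
      refine hfull (T'.biUnion P) ?_ ?_ ?_ ?_ ?_
      · intro R hR
        obtain ⟨C, hC, hR⟩ := Finset.mem_biUnion.1 hR
        exact (hPA C (hT'T hC)).ring R hR
      · intro R hR
        obtain ⟨C, hC, hR⟩ := Finset.mem_biUnion.1 hR
        exact (((hPA C (hT'T hC)).sub R hR).trans (hPA C (hT'T hC)).subset).trans
          (hCA C (hT'T hC))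
      · intro R hR
        obtain ⟨C, hC, hR⟩ := Finset.mem_biUnion.1 hR
        exact (hPA C (hT'T hC)).bad R hR
      · intro R hR R' hR' hne
        obtain ⟨C, hC, hR⟩ := Finset.mem_biUnion.1 (Finset.mem_coe.1 hR)
        obtain ⟨C', hC', hR'⟩ := Finset.mem_biUnion.1 (Finset.mem_coe.1 hR')
        by_cases e : C = C'
        · subst e
          exact (hPA C (hT'T hC)).disj hR hR' hne
        · exact hdisT C (hT'T hC) C' (hT'T hC') e R hR R' hR'
      · rw [Finset.card_biUnion]
        · have h1 : ∑ C ∈ T', (M C + ν) ≤ ∑ C ∈ T', 2 * ν * (P C).card := Finset.sum_le_sum hcount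
          rw [Finset.sum_add_distrib, ← Finset.mul_sum] at h1
          simp only [Finset.sum_const, smul_eq_mul] at h1
          nlinarith
        · intro C hC C' hC' hne
          rw [Function.onFun, Finset.disjoint_left]
          intro R hR hR'
          have h1 := hdisT C (hT'T hC) C' (hT'T hC') hne R hR R hR'
          exact (nonempty_of_bad ((hPA C (hT'T hC)).bad R hR)).ne_empty (disjoint_self.1 h1)

theorem exists_level_Ep_lt {p : ℝ} (hf : MemLpS F S p f) (hε : 0 < ε) :
    ∃ m, ∀ A ∈ F.atoms m, Ep S p μ f A < ε := by
  obtain ⟨n, y, hy, hyε⟩ := hf.2.2 ε hε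
  obtain ⟨c, g, A, hg, hA, rfl⟩ := exists_repr_of_mem_SigmaN hy
  choose k hk using fun j => mem_iUnion.1 (hA j)
  refine ⟨Finset.univ.sup k, fun R hR => ?_⟩
  have hun : ∀ j, R ⊆ A j ∨ Disjoint R (A j) := fun j =>
    (F.subset_or_disjoint (Finset.le_sup (f := k) (Finset.mem_univ j)) (hk j) hR).imp_right
      fun h => h.symm
  obtain ⟨u, hu, hyu⟩ := exists_eqOn_of_uncut c g hg A hun
  exact (Ep_le_of_eqOn hu (F.atoms_measurable _ R hR) hyu).trans_lt hyε

theorem bestApprox_anti {D : Set (Ω → ℝ)} (hD : D.Nonempty) {a b : ℕ} (h : a ≤ b) :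
    bestApprox D p μ f b ≤ bestApprox D p μ f a :=
  biInf_mono (SigmaN_mono hD h)

theorem bestApprox_le_eLpNorm {D : Set (Ω → ℝ)} (hD : D.Nonempty) (n : ℕ) :
    bestApprox D p μ f n ≤ eLpNorm f (ENNReal.ofReal p) μ := by
  refine (iInf₂_le 0 (SigmaN_mono hD (Nat.zero_le n) zero_mem_SigmaN_zero)).trans ?_
  simp

/-- Jackson inequality along multiples of `4 ν`. -/
theorem bestApprox_le_varSeminorm {σ : ℝ} (hFν : F.IsNuAry ν) (hν : 0 < ν) (hσ : 0 < σ)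
    (hσp : σ < p) (hf : MemLpS F S p f) {n : ℕ} (hn : 0 < n) :
    bestApprox (dictC F S) p μ f (4 * ν * n) ≤
      ((2 * ν : ℕ) : ℝ≥0∞) ^ (1 / p) * ((n : ℝ≥0∞) ^ (-(1 / σ - 1 / p)) *
        varSeminorm F S σ p f) := by
  have hp : 0 < p := hσ.trans hσp
  have hn0 : (n : ℝ≥0∞) ≠ 0 := by exact_mod_cast hn.ne'
  have hnt : (n : ℝ≥0∞) ≠ ∞ := ENNReal.natCast_ne_top n
  have hc0 : ((2 * ν * n : ℕ) : ℝ≥0∞) ^ (1 / p) ≠ 0 := by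
    refine (ENNReal.rpow_pos ?_ (ENNReal.natCast_ne_top _)).ne'
    exact_mod_cast (by positivity : 0 < 2 * ν * n)
  have hct : ((2 * ν * n : ℕ) : ℝ≥0∞) ^ (1 / p) ≠ ∞ :=
    (ENNReal.rpow_lt_top_of_nonneg (by positivity) (ENNReal.natCast_ne_top _)).ne
  have main : bestApprox (dictC F S) p μ f (4 * ν * n) ≤
      ((2 * ν * n : ℕ) : ℝ≥0∞) ^ (1 / p) * ((n : ℝ≥0∞) ^ (-(1 / σ)) * varSeminorm F S σ p f) := by
    rw [← ENNReal.div_le_iff' hc0 hct]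
    refine le_of_forall_gt_imp_ge_of_dense fun ε hε => ?_
    rw [ENNReal.div_le_iff' hc0 hct]
    have hε0 : 0 < ε := zero_le.trans_lt hε
    obtain ⟨m, hm⟩ := exists_level_Ep_lt hf hε0
    obtain ⟨B, M, y, P, h⟩ := exists_partialApprox hFν hν hp hε0 hm m 0 (zero_add m) univ
      (by simp [F.atoms_zero])
    obtain ⟨z, hz, -, hzε⟩ := h.complete hp (univ_mem_Atoms F)
    have hcard : P.card < n := by
      have h1 := card_mul_rpow_le_varSeminorm_rpow hσ f h.ring h.disj h.bad
      have h2 : varSeminorm F S σ p f < (n : ℝ≥0∞) ^ (1 / σ) * ε := by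
        rw [ENNReal.rpow_neg] at hε
        have hx0 : (n : ℝ≥0∞) ^ (1 / σ) ≠ 0 := (ENNReal.rpow_pos (pos_iff_ne_zero.2 hn0) hnt).ne'
        have hxt : (n : ℝ≥0∞) ^ (1 / σ) ≠ ∞ :=
          (ENNReal.rpow_lt_top_of_nonneg (by positivity) hnt).ne
        rw [mul_comm, ← div_eq_mul_inv] at hε
        rw [mul_comm]
        exact (ENNReal.div_lt_iff (Or.inl hx0) (Or.inl hxt)).1 hε
      have h3 := ENNReal.rpow_lt_rpow h2 hσ
      rw [ENNReal.mul_rpow_of_nonneg _ _ hσ.le, ← ENNReal.rpow_mul, one_div_mul_cancel hσ.ne',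
        ENNReal.rpow_one] at h3
      have h4 := h1.trans_lt h3
      have h5 := lt_of_mul_lt_mul_right' h4
      exact_mod_cast h5
    have hM : M + 1 ≤ 2 * ν * n := by
      rcases h.count with ⟨rfl, -⟩ | h'
      · have : 0 < ν * n := by positivity
        nlinarith
      · nlinarith
    calc bestApprox (dictC F S) p μ f (4 * ν * n)
        ≤ bestApprox (dictC F S) p μ f (2 * (M + 1)) :=
          bestApprox_anti dictC_nonempty (by nlinarith)
      _ ≤ eLpNorm (f - z) (ENNReal.ofReal p) μ := iInf₂_le z hz
      _ ≤ (((2 * ν * n : ℕ) : ℝ≥0∞) * ε ^ p) ^ (1 / p) := by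
          rw [one_div, ENNReal.le_rpow_inv_iff hp, eLpNorm_ofReal_rpow hp]
          rw [Measure.restrict_univ] at hzε
          exact hzε.trans (by gcongr)
      _ = ((2 * ν * n : ℕ) : ℝ≥0∞) ^ (1 / p) * ε := by
          rw [ENNReal.mul_rpow_of_nonneg _ _ (by positivity), ← ENNReal.rpow_mul,
            mul_one_div_cancel hp.ne', ENNReal.rpow_one]
  refine main.trans_eq ?_
  have e : -(1 / σ - 1 / p) = 1 / p + -(1 / σ) := by ring
  rw [Nat.cast_mul (2 * ν) n, ENNReal.mul_rpow_of_nonneg _ _ (by positivity), e,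
    ENNReal.rpow_add _ _ hn0 hnt]
  ring

end Jackson

/-! ### Comparison of approximation and interpolation quasi-norms -/

section TwoRpow

theorem ENNReal.two_rpow_ne_zero (x : ℝ) : (2 : ℝ≥0∞) ^ x ≠ 0 := by
  simp [ENNReal.rpow_eq_zero_iff]

theorem ENNReal.two_rpow_ne_top (x : ℝ) : (2 : ℝ≥0∞) ^ x ≠ ∞ := by
  simp [ENNReal.rpow_eq_top_iff]

theorem ENNReal.two_rpow_add (x y : ℝ) : (2 : ℝ≥0∞) ^ (x + y) = 2 ^ x * 2 ^ y :=
  ENNReal.rpow_add x y (by norm_num) (by norm_num)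

theorem ENNReal.two_rpow_mono {x y : ℝ} (h : x ≤ y) : (2 : ℝ≥0∞) ^ x ≤ 2 ^ y :=
  ENNReal.rpow_le_rpow_of_exponent_le (by norm_num) h

theorem ENNReal.natCast_two_pow_rpow (k : ℕ) (x : ℝ) :
    ((2 ^ k : ℕ) : ℝ≥0∞) ^ x = 2 ^ (k * x) := by
  rw [ENNReal.rpow_mul, ENNReal.rpow_natCast]
  push_cast
  rfl

theorem ENNReal.one_le_two_rpow {x : ℝ} (h : 0 ≤ x) : (1 : ℝ≥0∞) ≤ 2 ^ x := by
  simpa using ENNReal.two_rpow_mono h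

theorem ENNReal.two_rpow_lt_one {x : ℝ} (h : x < 0) : (2 : ℝ≥0∞) ^ x < 1 :=
  ENNReal.rpow_lt_one_of_one_lt_of_neg (by norm_num) h

/-- A finite solution `G` of the inequality `r G + H ≤ G` with `0 ≤ r < 1`. -/
theorem ENNReal.exists_mul_add_le {r H : ℝ≥0∞} (hr : r < 1) (hH : H ≠ ∞) :
    ∃ G : ℝ≥0∞, G ≠ ∞ ∧ H ≤ G ∧ r * G + H ≤ G := by
  have h0 : 1 - r ≠ 0 := (tsub_pos_of_lt hr).ne'
  have ht : 1 - r ≠ ∞ := ne_top_of_le_ne_top one_ne_top tsub_le_self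
  have h1 : r * (1 - r)⁻¹ + 1 = (1 - r)⁻¹ := by
    calc r * (1 - r)⁻¹ + 1 = r * (1 - r)⁻¹ + (1 - r) * (1 - r)⁻¹ := by
          rw [ENNReal.mul_inv_cancel h0 ht]
      _ = (1 - r)⁻¹ := by rw [← add_mul, add_tsub_cancel_of_le hr.le, one_mul]
  have h2 : r * (H * (1 - r)⁻¹) + H = H * (1 - r)⁻¹ := by
    calc r * (H * (1 - r)⁻¹) + H = H * (r * (1 - r)⁻¹ + 1) := by ring
      _ = _ := by rw [h1]
  exact ⟨H * (1 - r)⁻¹, ENNReal.mul_ne_top hH (ENNReal.inv_ne_top.2 h0),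
    le_add_self.trans h2.le, h2.le⟩

end TwoRpow

section Comparison

variable {Ω : Type} [MeasurableSpace Ω] {μ : Measure Ω} {F : FiltrationAtoms Ω μ}
  {S : Submodule ℝ (Ω → ℝ)} {σ p τ : ℝ} {f : Ω → ℝ} {ν : ℕ}

/-- Jackson inequality for the variation norm. -/
theorem exists_bestApprox_le_varNorm (hFν : F.IsNuAry ν) (hν : 0 < ν) (hσ : 0 < σ)
    (hσp : σ < p) :
    ∃ C : ℝ≥0∞, C ≠ ∞ ∧ ∀ g, MemLpS F S p g → ∀ N : ℕ, 0 < N →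
      bestApprox (dictC F S) p μ g N ≤
        C * ((N : ℝ≥0∞) ^ (-(1 / σ - 1 / p)) * varNorm F S σ p g) := by
  have hp : 0 < p := hσ.trans hσp
  have hβ : 0 < 1 / σ - 1 / p := sub_pos.2 (one_div_lt_one_div_of_lt hσ hσp)
  set β := 1 / σ - 1 / p with hβ_def
  have h8t : ((8 * ν : ℕ) : ℝ≥0∞) ^ β ≠ ∞ :=
    ENNReal.rpow_ne_top_of_nonneg hβ.le (ENNReal.natCast_ne_top _)
  have h2t : ((2 * ν : ℕ) : ℝ≥0∞) ^ (1 / p) ≠ ∞ :=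
    ENNReal.rpow_ne_top_of_nonneg (by positivity) (ENNReal.natCast_ne_top _)
  refine ⟨((2 * ν : ℕ) : ℝ≥0∞) ^ (1 / p) * ((8 * ν : ℕ) : ℝ≥0∞) ^ β + ((8 * ν : ℕ) : ℝ≥0∞) ^ β,
    ENNReal.add_ne_top.2 ⟨ENNReal.mul_ne_top h2t h8t, h8t⟩, fun g hg N hN => ?_⟩
  have key : ∀ n : ℕ, 0 < n → N ≤ 8 * ν * n →
      (n : ℝ≥0∞) ^ (-β) ≤ ((8 * ν : ℕ) : ℝ≥0∞) ^ β * (N : ℝ≥0∞) ^ (-β) := by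
    intro n hn hNn
    have hn0 : (n : ℝ≥0∞) ^ β ≠ 0 := by
      simp [ENNReal.rpow_eq_zero_iff, hn.ne', hβ.not_gt]
    have hN0 : (N : ℝ≥0∞) ^ β ≠ 0 := by
      simp [ENNReal.rpow_eq_zero_iff, hN.ne', hβ.not_gt]
    have hNt : (N : ℝ≥0∞) ^ β ≠ ∞ :=
      ENNReal.rpow_ne_top_of_nonneg hβ.le (ENNReal.natCast_ne_top _)
    rw [ENNReal.rpow_neg, ENNReal.rpow_neg, ← div_eq_mul_inv,
      ENNReal.le_div_iff_mul_le (Or.inl hN0) (Or.inl hNt), mul_comm, ← div_eq_mul_inv]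
    refine ENNReal.div_le_of_le_mul ?_
    rw [← ENNReal.mul_rpow_of_nonneg _ _ hβ.le]
    gcongr
    exact_mod_cast hNn
  by_cases h : N < 4 * ν
  · have h1 := key 1 one_pos (by omega)
    rw [Nat.cast_one, ENNReal.one_rpow] at h1
    calc bestApprox (dictC F S) p μ g N ≤ eLpNorm g (ENNReal.ofReal p) μ :=
          bestApprox_le_eLpNorm dictC_nonempty N
      _ ≤ 1 * varNorm F S σ p g := by rw [one_mul]; exact le_self_add
      _ ≤ ((8 * ν : ℕ) : ℝ≥0∞) ^ β * (N : ℝ≥0∞) ^ (-β) * varNorm F S σ p g := by gcongr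
      _ = ((8 * ν : ℕ) : ℝ≥0∞) ^ β * ((N : ℝ≥0∞) ^ (-β) * varNorm F S σ p g) := mul_assoc _ _ _
      _ ≤ _ := by gcongr; exact le_add_self
  · have hn : 0 < N / (4 * ν) := Nat.div_pos (by omega) (by omega)
    have hle : 4 * ν * (N / (4 * ν)) ≤ N := Nat.mul_div_le _ _
    have hlt : N < 4 * ν * (N / (4 * ν)) + 4 * ν := by
      have := Nat.lt_mul_div_succ N (show 0 < 4 * ν by omega)
      rwa [mul_add, mul_one] at this
    have hN8 : N ≤ 8 * ν * (N / (4 * ν)) := by nlinarith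
    calc bestApprox (dictC F S) p μ g N
        ≤ bestApprox (dictC F S) p μ g (4 * ν * (N / (4 * ν))) :=
          bestApprox_anti dictC_nonempty hle
      _ ≤ _ := bestApprox_le_varSeminorm hFν hν hσ hσp hg hn
      _ ≤ ((2 * ν : ℕ) : ℝ≥0∞) ^ (1 / p) * (((8 * ν : ℕ) : ℝ≥0∞) ^ β * (N : ℝ≥0∞) ^ (-β) *
          varNorm F S σ p g) := by
          gcongr
          · exact key _ hn hN8
          · exact le_add_self
      _ = ((2 * ν : ℕ) : ℝ≥0∞) ^ (1 / p) * ((8 * ν : ℕ) : ℝ≥0∞) ^ β * ((N : ℝ≥0∞) ^ (-β) *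
          varNorm F S σ p g) := by ring
      _ ≤ _ := by gcongr; exact le_self_add

theorem Kfun_mono {Y : Set (Ω → ℝ)} {yNorm : (Ω → ℝ) → ℝ≥0∞} {s t : ℝ≥0∞} (h : s ≤ t) :
    Kfun p μ Y yNorm f s ≤ Kfun p μ Y yNorm f t :=
  iInf₂_mono fun _ _ => by gcongr

theorem eLpNorm_le_Kfun_one (hσ : 0 < σ) (hσp : σ < p) (hf : AEMeasurable f μ) :
    eLpNorm f (ENNReal.ofReal p) μ ≤
      2 ^ (1 / min 1 σ) * Kfun p μ {g | MemVar F S σ p g} (varNorm F S σ p) f 1 := by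
  rw [← ENNReal.div_le_iff' (two_rpow_ne_zero _) (two_rpow_ne_top _)]
  refine le_iInf₂ fun g hg => ?_
  rw [ENNReal.div_le_iff' (two_rpow_ne_zero _) (two_rpow_ne_top _), one_mul]
  have h := eLpNorm_add_rpow_le (lt_min one_pos hσ) (min_le_left _ _)
    ((min_le_right _ _).trans hσp.le) (hf.sub hg.1.1) hg.1.1
  rw [sub_add_cancel] at h
  refine (ENNReal.le_two_rpow_mul_add_of_rpow_le (lt_min one_pos hσ) h).trans ?_
  gcongr
  exact le_self_add

variable [IsProbabilityMeasure μ]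

theorem bestApprox_le_add (hSmeas : ∀ g ∈ S, Measurable g)
    (hSbdd : ∀ g ∈ S, eLpNormEssSup g μ ≠ ∞) (hτ : 0 < τ) (hτ1 : τ ≤ 1) (hτp : τ ≤ p)
    {g : Ω → ℝ} (hf : AEMeasurable f μ) (hg : AEMeasurable g μ) (N : ℕ) :
    bestApprox (dictC F S) p μ f N ≤
      2 ^ (1 / τ) * (eLpNorm (f - g) (ENNReal.ofReal p) μ + bestApprox (dictC F S) p μ g N) := by
  rw [← ENNReal.div_le_iff' (two_rpow_ne_zero _) (two_rpow_ne_top _)]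
  unfold bestApprox
  simp only [ENNReal.add_iInf]
  refine le_iInf₂ fun y hy => ?_
  rw [ENNReal.div_le_iff' (two_rpow_ne_zero _) (two_rpow_ne_top _)]
  refine (iInf₂_le y hy).trans (ENNReal.le_two_rpow_mul_add_of_rpow_le hτ ?_)
  have hy' : AEMeasurable y μ := (memLp_of_mem_SigmaN hSmeas hSbdd p hy).1.aemeasurable
  have h := eLpNorm_add_rpow_le hτ hτ1 hτp (hf.sub hg) (hg.sub hy')
  rwa [sub_add_sub_cancel] at h

theorem exists_bestApprox_le_Kfun (hSmeas : ∀ g ∈ S, Measurable g)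
    (hSbdd : ∀ g ∈ S, eLpNormEssSup g μ ≠ ∞) (hFν : F.IsNuAry ν) (hν : 0 < ν) (hσ : 0 < σ)
    (hσp : σ < p) :
    ∃ C : ℝ≥0∞, C ≠ ∞ ∧ ∀ f, MemLpS F S p f → ∀ (N : ℕ) (t : ℝ≥0∞), 0 < N →
      (N : ℝ≥0∞) ^ (-(1 / σ - 1 / p)) ≤ t →
      bestApprox (dictC F S) p μ f N ≤
        C * Kfun p μ {g | MemVar F S σ p g} (varNorm F S σ p) f t := by
  obtain ⟨J, hJt, hJ⟩ := exists_bestApprox_le_varNorm (S := S) hFν hν hσ hσp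
  have hτ : 0 < min 1 σ := lt_min one_pos hσ
  set c : ℝ≥0∞ := 2 ^ (1 / min 1 σ) with hc
  have hc0 : c ≠ 0 := two_rpow_ne_zero _
  have hct : c ≠ ∞ := two_rpow_ne_top _
  have hC0 : c * (1 + J) ≠ 0 := mul_ne_zero hc0 (by simp)
  have hCt : c * (1 + J) ≠ ∞ :=
    ENNReal.mul_ne_top hct (ENNReal.add_ne_top.2 ⟨one_ne_top, hJt⟩)
  refine ⟨c * (1 + J), hCt, fun f hf N t hN hNt => ?_⟩
  rw [← ENNReal.div_le_iff' hC0 hCt]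
  refine le_iInf₂ fun g hg => ?_
  rw [ENNReal.div_le_iff' hC0 hCt]
  calc bestApprox (dictC F S) p μ f N
      ≤ c * (eLpNorm (f - g) (ENNReal.ofReal p) μ + bestApprox (dictC F S) p μ g N) :=
        bestApprox_le_add hSmeas hSbdd hτ (min_le_left _ _) ((min_le_right _ _).trans hσp.le)
          hf.1 hg.1.1 N
    _ ≤ c * ((1 + J) * eLpNorm (f - g) (ENNReal.ofReal p) μ +
          (1 + J) * (t * varNorm F S σ p g)) := by
        gcongr
        · exact le_mul_of_one_le_left zero_le le_self_add
        · refine (hJ g hg.1 N hN).trans ?_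
          gcongr
          exact le_add_self
    _ = _ := by ring

theorem exists_approxNorm_le_interpNorm (hSmeas : ∀ g ∈ S, Measurable g)
    (hSbdd : ∀ g ∈ S, eLpNormEssSup g μ ≠ ∞) (hFν : F.IsNuAry ν) (hν : 0 < ν) (hσ : 0 < σ)
    (hσp : σ < p) {α : ℝ} (hα : 0 < α) {q : ℝ≥0∞} (hq : 0 < q) :
    ∃ C : ℝ≥0∞, C ≠ ∞ ∧ ∀ f, MemLpS F S p f →
      approxNorm (dictC F S) p q α μ f ≤
        C * interpNorm p μ {g | MemVar F S σ p g} (varNorm F S σ p)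
          (α / (1 / σ - 1 / p)) q f := by
  have hβ : 0 < 1 / σ - 1 / p := sub_pos.2 (one_div_lt_one_div_of_lt hσ hσp)
  obtain ⟨C₁, hC₁t, hC₁⟩ := exists_bestApprox_le_Kfun hSmeas hSbdd hFν hν hσ hσp
  set β := 1 / σ - 1 / p with hβ_def
  obtain ⟨C₂, hC₂t, hC₂⟩ := exists_lqNorm_comp_floor_le hq hβ
  have hθ : 0 < α / β := by positivity
  refine ⟨2 ^ (1 / min 1 σ) + C₁ * 2 ^ (α / β) * C₂, ENNReal.add_ne_top.2
    ⟨two_rpow_ne_top _, ENNReal.mul_ne_top (ENNReal.mul_ne_top hC₁t (two_rpow_ne_top _)) hC₂t⟩,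
    fun f hf => ?_⟩
  unfold approxNorm interpNorm
  set b : ℕ → ℝ≥0∞ := fun n => (2 : ℝ≥0∞) ^ ((n : ℝ) * (α / β)) *
    Kfun p μ {g | MemVar F S σ p g} (varNorm F S σ p) f ((2 : ℝ≥0∞) ^ (-(n : ℝ))) with hb
  rw [add_mul]
  refine add_le_add ?_ ?_
  · have h0 : b 0 = Kfun p μ {g | MemVar F S σ p g} (varNorm F S σ p) f 1 := by simp [hb]
    refine (eLpNorm_le_Kfun_one (F := F) (S := S) hσ hσp hf.1).trans ?_
    rw [← h0]
    gcongr
    exact le_lqNorm hq b 0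
  · calc lqNorm q (fun n => (2 : ℝ≥0∞) ^ ((n : ℝ) * α) * bestApprox (dictC F S) p μ f (2 ^ n))
        ≤ lqNorm q (fun n => C₁ * 2 ^ (α / β) * b ⌊(n : ℝ) * β⌋₊) := by
          refine lqNorm_mono q fun n => ?_
          have hfl : (⌊(n : ℝ) * β⌋₊ : ℝ) ≤ n * β := Nat.floor_le (by positivity)
          have hfl' : (n : ℝ) * β < ⌊(n : ℝ) * β⌋₊ + 1 := Nat.lt_floor_add_one _
          have hK := hC₁ f hf (2 ^ n) (2 ^ (-(⌊(n : ℝ) * β⌋₊ : ℝ))) (by positivity) (by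
            rw [natCast_two_pow_rpow]
            exact two_rpow_mono (by linarith))
          have hexp : (n : ℝ) * α ≤ α / β + ⌊(n : ℝ) * β⌋₊ * (α / β) := by
            calc (n : ℝ) * α = n * β * (α / β) := by field_simp
              _ ≤ (⌊(n : ℝ) * β⌋₊ + 1) * (α / β) := by gcongr
              _ = _ := by ring
          calc _ ≤ (2 : ℝ≥0∞) ^ (α / β + ⌊(n : ℝ) * β⌋₊ * (α / β)) * (C₁ * _) :=
                mul_le_mul' (two_rpow_mono hexp) hK
            _ = _ := by rw [two_rpow_add, hb]; ring
      _ ≤ C₁ * 2 ^ (α / β) * lqNorm q (fun n => b ⌊(n : ℝ) * β⌋₊) := lqNorm_const_mul_le hq _ _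
      _ ≤ C₁ * 2 ^ (α / β) * (C₂ * lqNorm q b) := by gcongr; exact hC₂ b
      _ = _ := by ring

/-- The `K`-functional is controlled by the errors of best approximation up to level `n`. -/
theorem exists_Kfun_le_of_bestApprox_lt (hSmeas : ∀ g ∈ S, Measurable g)
    (hSbdd : ∀ g ∈ S, eLpNormEssSup g μ ≠ ∞) (hσ : 0 < σ) (hσp : σ < p) {β' : ℝ}
    (hβ' : 0 < β') (hβ'β : β' < 1 / σ - 1 / p) :
    ∃ C : ℝ≥0∞, C ≠ 0 ∧ C ≠ ∞ ∧ ∀ f, MemLpS F S p f → ∀ (n : ℕ) (D : ℝ≥0∞),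
      eLpNorm f (ENNReal.ofReal p) μ ≤ D * 2 ^ (n * β') →
      (∀ k ≤ n, bestApprox (dictC F S) p μ f (2 ^ k) < D * 2 ^ ((n - k : ℝ) * β')) →
      Kfun p μ {g | MemVar F S σ p g} (varNorm F S σ p) f (2 ^ (-(n * (1 / σ - 1 / p)))) ≤
        C * D := by
  set β := 1 / σ - 1 / p with hβ_def
  have hβ : 0 < β := hβ'.trans hβ'β
  obtain ⟨τ, hτ_def⟩ : ∃ τ, τ = min 1 σ := ⟨_, rfl⟩
  have hτ : 0 < τ := hτ_def ▸ lt_min one_pos hσ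
  have hτ1 : τ ≤ 1 := hτ_def ▸ min_le_left _ _
  have hτσ : τ ≤ σ := hτ_def ▸ min_le_right _ _
  have hτp : τ ≤ p := hτσ.trans hσp.le
  set r : ℝ≥0∞ := 2 ^ (-((β - β') * τ)) with hr
  have hr1 : r < 1 := two_rpow_lt_one (by nlinarith)
  set H : ℝ≥0∞ := 2 * 2 ^ ((β + β') * τ) with hH
  have hHt : H ≠ ∞ := ENNReal.mul_ne_top (by norm_num) (two_rpow_ne_top _)
  have hH2 : 2 ≤ H := le_mul_of_one_le_right zero_le (one_le_two_rpow (by positivity))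
  obtain ⟨G, hGt, hHG, hG⟩ := ENNReal.exists_mul_add_le hr1 hHt
  have hGt' : G ^ (1 / τ) ≠ ∞ := ENNReal.rpow_ne_top_of_nonneg (by positivity) hGt
  refine ⟨1 + (2 * 2 ^ (1 / τ) + G ^ (1 / τ)), by simp, ENNReal.add_ne_top.2 ⟨one_ne_top,
    ENNReal.add_ne_top.2 ⟨ENNReal.mul_ne_top (by norm_num) (two_rpow_ne_top _), hGt'⟩⟩,
    fun f hf n D hfD hD => ?_⟩
  have hex : ∀ k, ∃ y, k ≤ n → y ∈ SigmaN (dictC F S) (2 ^ k) ∧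
      eLpNorm (f - y) (ENNReal.ofReal p) μ ≤ D * 2 ^ ((n - k : ℝ) * β') := by
    intro k
    by_cases hk : k ≤ n
    · obtain ⟨y, hy, h⟩ := (by simpa only [bestApprox, iInf_lt_iff] using hD k hk :
        ∃ y, ∃ _ : y ∈ SigmaN (dictC F S) (2 ^ k), eLpNorm (f - y) (ENNReal.ofReal p) μ <
          D * 2 ^ ((n - k : ℝ) * β'))
      exact ⟨y, fun _ => ⟨hy, h.le⟩⟩
    · exact ⟨0, fun h => absurd h hk⟩
  choose y hy using hex
  have hmeas : ∀ k ≤ n, AEMeasurable (y k) μ := fun k hk =>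
    (memLp_of_mem_SigmaN hSmeas hSbdd p (hy k hk).1).1.aemeasurable
  have hmulτ : ∀ (a b : ℝ≥0∞) (x : ℝ), a ≤ b * 2 ^ x → a ^ τ ≤ b ^ τ * 2 ^ (x * τ) := by
    intro a b x h
    calc a ^ τ ≤ (b * 2 ^ x) ^ τ := ENNReal.rpow_le_rpow h hτ.le
      _ = _ := by rw [ENNReal.mul_rpow_of_nonneg _ _ hτ.le, ENNReal.rpow_mul]
  have hbern : ∀ (k : ℕ) (z : Ω → ℝ), z ∈ SigmaN (dictC F S) (2 ^ k) →
      varSeminorm F S σ p z ^ τ ≤ eLpNorm z (ENNReal.ofReal p) μ ^ τ * 2 ^ (k * β * τ) := by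
    intro k z hz
    refine hmulτ _ _ _ ?_
    rw [← natCast_two_pow_rpow, mul_comm]
    exact varSeminorm_le_of_mem_SigmaN hσ hσp hz
  have hynorm : ∀ k ≤ n, eLpNorm (y k) (ENNReal.ofReal p) μ ^ τ ≤
      eLpNorm f (ENNReal.ofReal p) μ ^ τ + eLpNorm (f - y k) (ENNReal.ofReal p) μ ^ τ := by
    intro k hk
    have h := eLpNorm_sub_rpow_le hτ hτ1 hτp hf.1 (hf.1.sub (hmeas k hk))
    rwa [_root_.sub_sub_cancel] at h
  have hvar : ∀ j ≤ n, varSeminorm F S σ p (y j) ^ τ ≤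
      G * (D ^ τ * 2 ^ ((j * β + (n - j : ℝ) * β') * τ)) := by
    intro j
    induction j with
    | zero =>
      intro h0
      have h1 := hbern 0 (y 0) (hy 0 h0).1
      have h2 := hmulτ _ _ _ hfD
      have h3 := hmulτ _ _ _ (hy 0 h0).2
      simp only [Nat.cast_zero, zero_mul, ENNReal.rpow_zero, mul_one, sub_zero, zero_add]
        at h1 h2 h3 ⊢
      calc _ ≤ _ := h1
        _ ≤ _ := hynorm 0 h0
        _ ≤ _ := add_le_add h2 h3
        _ = 2 * (D ^ τ * 2 ^ (n * β' * τ)) := (two_mul _).symm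
        _ ≤ _ := by gcongr; exact hH2.trans hHG
    | succ k ih =>
      intro hk1
      have hk : k ≤ n := by omega
      have hd : y (k + 1) - y k ∈ SigmaN (dictC F S) (2 ^ (k + 2)) :=
        SigmaN_mono dictC_nonempty (by rw [pow_add, pow_add]; omega)
          (SigmaN_sub (hy (k + 1) hk1).1 (hy k hk).1)
      have hdnorm : eLpNorm (y (k + 1) - y k) (ENNReal.ofReal p) μ ^ τ ≤
          2 * (D ^ τ * 2 ^ ((n - k : ℝ) * β' * τ)) := by
        have h := eLpNorm_sub_rpow_le hτ hτ1 hτp (hf.1.sub (hmeas k hk))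
          (hf.1.sub (hmeas (k + 1) hk1))
        rw [_root_.sub_sub_sub_cancel_left] at h
        rw [two_mul]
        refine h.trans (add_le_add (hmulτ _ _ _ (hy k hk).2)
          ((hmulτ _ _ _ (hy (k + 1) hk1).2).trans ?_))
        gcongr
        · norm_num
        · linarith
      have hadd := varSeminorm_add_rpow_le (F := F) hSmeas hτ hτ1 hτσ hσp (hmeas k hk)
        ((hmeas (k + 1) hk1).sub (hmeas k hk))
      rw [add_sub_cancel] at hadd
      calc _ ≤ _ := hadd
        _ ≤ G * (D ^ τ * 2 ^ ((k * β + (n - k : ℝ) * β') * τ)) +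
            2 * (D ^ τ * 2 ^ ((n - k : ℝ) * β' * τ)) * 2 ^ ((k + 2 : ℕ) * β * τ) :=
          add_le_add (ih hk) ((hbern (k + 2) _ hd).trans (by gcongr))
        _ = (r * G + H) *
            (D ^ τ * 2 ^ (((k + 1 : ℕ) * β + (n - (k + 1 : ℕ) : ℝ) * β') * τ)) := by
          have e1 : (2 : ℝ≥0∞) ^ ((k * β + (n - k : ℝ) * β') * τ) =
              r * 2 ^ (((k + 1 : ℕ) * β + (n - (k + 1 : ℕ) : ℝ) * β') * τ) := by
            rw [hr, ← two_rpow_add]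
            congr 1
            push_cast
            ring
          have e2 : (2 : ℝ≥0∞) ^ ((n - k : ℝ) * β' * τ) * 2 ^ ((k + 2 : ℕ) * β * τ) =
              2 ^ ((β + β') * τ) *
                2 ^ (((k + 1 : ℕ) * β + (n - (k + 1 : ℕ) : ℝ) * β') * τ) := by
            rw [← two_rpow_add, ← two_rpow_add]
            congr 1
            push_cast
            ring
          rw [e1, mul_assoc, mul_assoc (D ^ τ), e2, hH]
          ring
        _ ≤ _ := by gcongr
  have hyn : eLpNorm (f - y n) (ENNReal.ofReal p) μ ≤ D := by
    simpa using (hy n le_rfl).2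
  have hnorm : eLpNorm (y n) (ENNReal.ofReal p) μ ≤ 2 * 2 ^ (1 / τ) * (D * 2 ^ (n * β)) := by
    have hu : (2 : ℝ≥0∞) ^ (n * β') ≤ 2 ^ (n * β) := two_rpow_mono (by gcongr)
    have hu1 : (1 : ℝ≥0∞) ≤ 2 ^ (n * β) := one_le_two_rpow (by positivity)
    calc _ ≤ _ := ENNReal.le_two_rpow_mul_add_of_rpow_le hτ (hynorm n le_rfl)
      _ ≤ 2 ^ (1 / τ) * (D * 2 ^ (n * β) + D * 2 ^ (n * β)) := by
        gcongr
        · exact hfD.trans (by gcongr)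
        · exact hyn.trans (le_mul_of_one_le_right zero_le hu1)
      _ = _ := by ring
  have hvarn : varSeminorm F S σ p (y n) ≤ G ^ (1 / τ) * (D * 2 ^ (n * β)) := by
    have h := hvar n le_rfl
    rw [sub_self, zero_mul, add_zero, ENNReal.rpow_mul, ← ENNReal.mul_rpow_of_nonneg _ _ hτ.le,
      mul_comm] at h
    have h' := ENNReal.sum_rpow_le_rpow_of_le hτ h
    rwa [← ENNReal.rpow_mul, mul_one_div_cancel hτ.ne', ENNReal.rpow_one, mul_comm] at h'
  calc Kfun p μ {g | MemVar F S σ p g} (varNorm F S σ p) f (2 ^ (-(n * β)))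
      ≤ eLpNorm (f - y n) (ENNReal.ofReal p) μ + 2 ^ (-(n * β)) * varNorm F S σ p (y n) :=
        iInf₂_le (y n) (memVar_of_mem_SigmaN hSmeas hSbdd hσ hσp (hy n le_rfl).1)
    _ ≤ D + 2 ^ (-(n * β)) *
          (2 * 2 ^ (1 / τ) * (D * 2 ^ (n * β)) + G ^ (1 / τ) * (D * 2 ^ (n * β))) := by
        gcongr
        exact add_le_add hnorm hvarn
    _ = D + (2 ^ (-(n * β)) * 2 ^ (n * β)) * ((2 * 2 ^ (1 / τ) + G ^ (1 / τ)) * D) := by ring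
    _ = _ := by
        rw [← two_rpow_add, neg_add_cancel, ENNReal.rpow_zero]
        ring

theorem exists_interpNorm_le_approxNorm (hSmeas : ∀ g ∈ S, Measurable g)
    (hSbdd : ∀ g ∈ S, eLpNormEssSup g μ ≠ ∞) (hσ : 0 < σ)
    (hσp : σ < p) {α : ℝ} (hα : 0 < α) (hαβ : α < 1 / σ - 1 / p) {q : ℝ≥0∞} (hq : 0 < q) :
    ∃ C : ℝ≥0∞, C ≠ ∞ ∧ ∀ f, MemLpS F S p f →
      interpNorm p μ {g | MemVar F S σ p g} (varNorm F S σ p) (α / (1 / σ - 1 / p)) q f ≤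
        C * approxNorm (dictC F S) p q α μ f := by
  obtain ⟨β', hαβ', hβ'β⟩ := exists_between hαβ
  obtain ⟨C₁, hC₁0, hC₁t, hC₁⟩ := exists_Kfun_le_of_bestApprox_lt (F := F) hSmeas hSbdd hσ hσp
    (hα.trans hαβ') hβ'β
  set β := 1 / σ - 1 / p with hβ_def
  have hβ : 0 < β := hα.trans hαβ
  set r : ℝ≥0∞ := 2 ^ (-(β' - α)) with hr
  obtain ⟨C₂, hC₂t, hC₂⟩ := exists_lqNorm_geom_iSup_le hq
    (show r < 1 from two_rpow_lt_one (by linarith))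
  obtain ⟨C₃, hC₃t, hC₃⟩ := exists_lqNorm_comp_floor_le hq (one_div_pos.2 hβ)
  have hC₄ : 2 * (2 : ℝ≥0∞) ^ (1 / q.toReal) ≠ ∞ :=
    ENNReal.mul_ne_top (by norm_num) (two_rpow_ne_top _)
  refine ⟨2 ^ α * (C₃ * (C₁ * (C₂ * (2 * 2 ^ (1 / q.toReal))))), by finiteness, fun f hf => ?_⟩
  set K := Kfun p μ {g | MemVar F S σ p g} (varNorm F S σ p) f with hK
  set a : ℕ → ℝ≥0∞ := fun n => 2 ^ ((n : ℝ) * α) * bestApprox (dictC F S) p μ f (2 ^ n) with ha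
  set s : ℕ → ℝ≥0∞ := fun n => if n = 0 then eLpNorm f (ENNReal.ofReal p) μ else 0 with hs
  set b : ℕ → ℝ≥0∞ := fun n => 2 ^ (n * α) * K (2 ^ (-(n * β))) with hb
  have hbound : ∀ n, b n ≤ C₁ * ⨆ x ∈ Finset.HasAntidiagonal.antidiagonal n,
      r ^ x.1 * (a x.2 + s x.2) := by
    intro n
    set M := ⨆ x ∈ Finset.HasAntidiagonal.antidiagonal n, r ^ x.1 * (a x.2 + s x.2) with hM
    have hle : ∀ k ≤ n, 2 ^ (-((n - k : ℝ) * (β' - α))) * (a k + s k) ≤ M := by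
      intro k hk
      have h : r ^ (n - k) * (a k + s k) ≤ M :=
        le_iSup₂ (f := fun (x : ℕ × ℕ) (_ : x ∈ Finset.HasAntidiagonal.antidiagonal n) =>
          r ^ x.1 * (a x.2 + s x.2)) (n - k, k) (by simp [hk])
      rw [hr, ← ENNReal.rpow_natCast, ← ENNReal.rpow_mul, Nat.cast_sub hk] at h
      convert h using 3
      ring
    have hKM : K (2 ^ (-(n * β))) / C₁ ≤ 2 ^ (-(n * α)) * M := by
      refine le_of_forall_gt_imp_ge_of_dense fun D hD => ?_
      rw [ENNReal.div_le_iff' hC₁0 hC₁t]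
      have hlt : ∀ x : ℝ, 2 ^ (x - n * α) * M < D * 2 ^ x := by
        intro x
        calc 2 ^ (x - n * α) * M = 2 ^ x * (2 ^ (-(n * α)) * M) := by
              rw [sub_eq_add_neg, two_rpow_add, mul_assoc]
          _ < 2 ^ x * D := by
              rwa [ENNReal.mul_lt_mul_iff_right (two_rpow_ne_zero _) (two_rpow_ne_top _)]
          _ = _ := mul_comm _ _
      refine hC₁ f hf n D ?_ fun k hk => ?_
      · refine le_trans ?_ (hlt (n * β')).le
        have h := hle 0 (Nat.zero_le n)
        calc eLpNorm f (ENNReal.ofReal p) μ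
            = 2 ^ (n * β' - n * α) * (2 ^ (-((n - (0 : ℕ) : ℝ) * (β' - α))) * s 0) := by
              rw [← mul_assoc, ← two_rpow_add]
              simp only [hs, if_true]
              ring_nf
              simp
          _ ≤ 2 ^ (n * β' - n * α) * M := by
              gcongr
              refine le_trans ?_ h
              gcongr
              exact le_add_self
      · refine lt_of_le_of_lt ?_ (hlt _)
        calc bestApprox (dictC F S) p μ f (2 ^ k)
            = 2 ^ ((n - k : ℝ) * β' - n * α) * (2 ^ (-((n - k : ℝ) * (β' - α))) * a k) := by
              simp only [ha]
              rw [← mul_assoc, ← mul_assoc, ← two_rpow_add, ← two_rpow_add]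
              ring_nf
              simp
          _ ≤ _ := by
              gcongr
              refine le_trans ?_ (hle k hk)
              gcongr
              exact le_self_add
    rw [ENNReal.div_le_iff' hC₁0 hC₁t] at hKM
    calc b n ≤ 2 ^ (n * α) * (C₁ * (2 ^ (-(n * α)) * M)) :=
          mul_le_mul_right hKM _
      _ = 2 ^ (n * α) * 2 ^ (-(n * α)) * (C₁ * M) := by ring
      _ = C₁ * M := by rw [← two_rpow_add, add_neg_cancel, ENNReal.rpow_zero, one_mul]
  calc interpNorm p μ {g | MemVar F S σ p g} (varNorm F S σ p) (α / β) q f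
      ≤ lqNorm q (fun m => 2 ^ α * b ⌊(m : ℝ) * (1 / β)⌋₊) := by
        refine lqNorm_mono q fun m => ?_
        have hfl : (⌊(m : ℝ) * (1 / β)⌋₊ : ℝ) ≤ m * (1 / β) := Nat.floor_le (by positivity)
        have hfl' : (m : ℝ) * (1 / β) < ⌊(m : ℝ) * (1 / β)⌋₊ + 1 := Nat.lt_floor_add_one _
        have e1 : (m : ℝ) * (α / β) ≤ α + ⌊(m : ℝ) * (1 / β)⌋₊ * α := by
          calc (m : ℝ) * (α / β) = m * (1 / β) * α := by ring
            _ ≤ (⌊(m : ℝ) * (1 / β)⌋₊ + 1) * α := by gcongr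
            _ = _ := by ring
        have e2 : -(m : ℝ) ≤ -(⌊(m : ℝ) * (1 / β)⌋₊ * β) := by
          have := mul_le_mul_of_nonneg_right hfl hβ.le
          rw [mul_assoc, one_div_mul_cancel hβ.ne', mul_one] at this
          linarith
        calc _ ≤ (2 : ℝ≥0∞) ^ (α + ⌊(m : ℝ) * (1 / β)⌋₊ * α) * K _ :=
              mul_le_mul' (two_rpow_mono e1) (Kfun_mono (two_rpow_mono e2))
          _ = _ := by rw [two_rpow_add, hb]; ring
    _ ≤ 2 ^ α * (C₃ * lqNorm q b) := (lqNorm_const_mul_le hq _ _).trans (mul_le_mul_right (hC₃ b) _)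
    _ ≤ 2 ^ α * (C₃ * (C₁ * (C₂ * lqNorm q (fun n => a n + s n)))) := by
        gcongr
        refine (lqNorm_mono q hbound).trans ((lqNorm_const_mul_le hq _ _).trans ?_)
        gcongr
        exact hC₂ (fun n => a n + s n)
    _ ≤ 2 ^ α * (C₃ * (C₁ * (C₂ * (2 * 2 ^ (1 / q.toReal) *
          (lqNorm q a + eLpNorm f (ENNReal.ofReal p) μ))))) := by
        gcongr
        refine (lqNorm_add_le hq a s).trans ?_
        gcongr
        exact lqNorm_single hq _
    _ = _ := by unfold approxNorm; rw [ha]; ring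

end Comparison

/-- For `0 < σ < p < ∞`, `β = 1/σ - 1/p`, `0 < α < β` and `0 < q ≤ ∞`,
the approximation space `𝒜_q^α(L^p(S), 𝒞)` coincides with the real interpolation space
`(L^p(S), V_{σ,p}(S))_{α/β, q}`, with equivalence of quasi-norms. -/
theorem statement0
    {Ω : Type} [MeasurableSpace Ω] {μ : Measure Ω} [IsProbabilityMeasure μ]
    (F : FiltrationAtoms Ω μ) (ν : ℕ) (hν : 2 ≤ ν) (hFν : F.IsNuAry ν)
    (S : Submodule ℝ (Ω → ℝ)) (hSfin : Module.Finite ℝ S)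
    (hSmeas : ∀ g ∈ S, Measurable g) (hSbdd : ∀ g ∈ S, eLpNormEssSup g μ ≠ ∞)
    (hstab : StabilityCondition F S)
    (σ p : ℝ) (hσ : 0 < σ) (hσp : σ < p)
    (α : ℝ) (hα : 0 < α) (hαβ : α < 1 / σ - 1 / p)
    (q : ℝ≥0∞) (hq : 0 < q) :
    ∃ C : ℝ≥0∞, 0 < C ∧ C ≠ ∞ ∧ ∀ f : Ω → ℝ, MemLpS F S p f →
      approxNorm (dictC F S) p q α μ f ≤
          C * interpNorm p μ {g | MemVar F S σ p g} (varNorm F S σ p)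
              (α / (1 / σ - 1 / p)) q f ∧
      interpNorm p μ {g | MemVar F S σ p g} (varNorm F S σ p)
          (α / (1 / σ - 1 / p)) q f ≤
        C * approxNorm (dictC F S) p q α μ f := by
  have hν0 : 0 < ν := by omega
  obtain ⟨C₁, hC₁t, hC₁⟩ :=
    exists_approxNorm_le_interpNorm hSmeas hSbdd hFν hν0 hσ hσp hα hq
  obtain ⟨C₂, hC₂t, hC₂⟩ :=
    exists_interpNorm_le_approxNorm (F := F) hSmeas hSbdd hσ hσp hα hαβ hq
  refine ⟨C₁ + C₂ + 1, by positivity, by finiteness, fun f hf => ⟨?_, ?_⟩⟩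
  · refine (hC₁ f hf).trans ?_
    gcongr
    exact le_self_add.trans le_self_add
  · refine (hC₂ f hf).trans ?_
    gcongr
    exact le_add_self.trans le_self_add
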